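/- Let \(\mathsf{D}\) be a finite-dimensional graded division algebra with center \(\mathsf{F}\) and canonical subalgebra \(\mathsf{C}=C_{\mathsf{D}}(\mathsf{U})\). Let \(\mathsf{M}\) be a maximal graded subfield of \(\mathsf{D}\) and \(\mathsf{T}\) a maximal graded subfield of \(\mathsf{C}\), and set \(\mathsf{M}'=(\mathsf{M}\cap C_{\mathsf{D}}(\mathsf{T}))\cdot\mathsf{T}\). Then \(\mathsf{M}'\) is a maximal graded subfield of \(\mathsf{D}\) whose degree-0 part \(\mathsf{M}'_0\) is a maximal subfield of \(\mathsf{D}_0\). Furthermore, if \(\mathsf{M}/\mathsf{F}\) is Galois (respectively, normal), then \(\mathsf{M}'/\mathsf{F}\) is Galois (respectively, normal) and \(\mathsf{M}'_0/\mathsf{F}_0\) is Galois (respectively, normal). -/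

import Mathlib

noncomputable section

namespace GradedDivPaper

variable {Γ : Type*} [AddCommGroup Γ] [DecidableEq Γ]
variable {D : Type*} [Ring D]

/-- The (additive) group `Γ` is torsion-free. -/
def TorsionFree (Γ : Type*) [AddCommGroup Γ] : Prop :=
  ∀ (γ : Γ) (n : ℕ), n ≠ 0 → n • γ = 0 → γ = 0

/-- A `Γ`-graded ring is a graded division ring if `1 ≠ 0` and every nonzero
homogeneous element is a unit. -/
def IsGradedDivisionRing (𝒜 : Γ → AddSubgroup D) [GradedRing 𝒜] : Prop :=
  (0 : D) ≠ 1 ∧ ∀ (γ : Γ), ∀ x ∈ 𝒜 γ, x ≠ 0 → IsUnit x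

/-- A subring `E` of a graded ring is a graded subring if it contains all homogeneous
components of each of its elements. -/
def IsGradedSubring (𝒜 : Γ → AddSubgroup D) [GradedRing 𝒜] (E : Subring D) : Prop :=
  ∀ x ∈ E, ∀ γ : Γ, (DirectSum.decompose 𝒜 x γ : D) ∈ E

/-- A graded subring which is itself a graded division ring (nonzero homogeneous elements
of `E` are invertible in `E`). -/
def IsGradedDivSubring (𝒜 : Γ → AddSubgroup D) [GradedRing 𝒜] (E : Subring D) : Prop :=
  IsGradedSubring 𝒜 E ∧
    ∀ (γ : Γ), ∀ x ∈ E, x ∈ 𝒜 γ → x ≠ 0 → ∃ y ∈ E, x * y = 1 ∧ y * x = 1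

/-- A graded subfield: a commutative graded division subring. -/
def IsGradedSubfield (𝒜 : Γ → AddSubgroup D) [GradedRing 𝒜] (K : Subring D) : Prop :=
  IsGradedDivSubring 𝒜 K ∧ ∀ x ∈ K, ∀ y ∈ K, x * y = y * x

/-- The grade set `Γ_E` of a subring `E`: the degrees in which `E` has nonzero
homogeneous elements. -/
def gradeSet (𝒜 : Γ → AddSubgroup D) (E : Subring D) : Set Γ :=
  {γ : Γ | ∃ x : D, x ∈ E ∧ x ∈ 𝒜 γ ∧ x ≠ 0}

/-- The index `|A : B|` of subsets of `Γ`: the number of classes of `A` modulo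
translation by `B`. -/
def addSetIndex (A B : Set Γ) : ℕ :=
  Nat.card (Quot (fun x y : A => (x : Γ) - (y : Γ) ∈ B))

/-- `[R : S]`: the rank of the ring `R` as a module over a subring `S`. -/
def dimOver {R : Type*} [Ring R] (S : Subring R) : ℕ := Module.finrank S R

/-- `R` has finite rank over the subring `S`. -/
def finiteOver {R : Type*} [Ring R] (S : Subring R) : Prop := Module.Finite S R

/-- `[A : B]`: the rank of a subring `A` of `R` over a subring `B` (i.e. over `B ∩ A`). -/
def relDim {R : Type*} [Ring R] (B A : Subring R) : ℕ :=
  Module.finrank (B.comap A.subtype) A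

/-- The degree-0 component of a graded ring, as a subring. -/
def grade0 (𝒜 : Γ → AddSubgroup D) [GradedRing 𝒜] : Subring D where
  carrier := 𝒜 0
  zero_mem' := (𝒜 0).zero_mem
  add_mem' := fun ha hb => (𝒜 0).add_mem ha hb
  neg_mem' := fun ha => (𝒜 0).neg_mem ha
  one_mem' := SetLike.one_mem_graded 𝒜
  mul_mem' := fun ha hb => by simpa using SetLike.mul_mem_graded ha hb

/-- `L/F` is a Galois extension (inside an ambient ring `R`): `F ≤ L` and `F` is exactly
the fixed ring of the group of ring automorphisms of `L` fixing `F` pointwise. -/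
def IsGaloisExt {R : Type*} [Ring R] (F L : Subring R) : Prop :=
  F ≤ L ∧ ∀ x : L,
    (∀ σ : L ≃+* L, (∀ y : L, (y : R) ∈ F → σ y = y) → σ x = x) → (x : R) ∈ F

/-- `p` is the minimal polynomial of `c` over the subring `F`: the monic polynomial with
coefficients in `F` annihilating `c` of least degree. -/
def IsMinPolyOf {R : Type*} [Ring R] (F : Subring R) (c : R) (p : Polynomial F) : Prop :=
  p.Monic ∧ Polynomial.eval₂ F.subtype c p = 0 ∧
    ∀ q : Polynomial F, q.Monic → Polynomial.eval₂ F.subtype c q = 0 → p.degree ≤ q.degree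

/-- The polynomial `p` over `F` splits into linear factors over `L`. -/
def SplitsIn {R : Type*} [Ring R] {F L : Subring R} (h : F ≤ L) (p : Polynomial F) : Prop :=
  ∃ s : List L,
    p.map (Subring.inclusion h) = (s.map fun a => Polynomial.X - Polynomial.C a).prod

/-- Normality for an extension of graded subfields: the minimal polynomial over `F` of
every homogeneous element of `L` splits over `L`. -/
def IsNormalExtGr (𝒜 : Γ → AddSubgroup D) [GradedRing 𝒜] (F L : Subring D) : Prop :=
  ∃ h : F ≤ L, ∀ c ∈ L, (∃ γ : Γ, c ∈ 𝒜 γ) →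
    ∀ p : Polynomial F, IsMinPolyOf F c p → SplitsIn h p

/-- Normality for an (ungraded) extension of subfields: the minimal polynomial over `F`
of every element of `L` splits over `L`. -/
def IsNormalExt {R : Type*} [Ring R] (F L : Subring R) : Prop :=
  ∃ h : F ≤ L, ∀ c ∈ L, ∀ p : Polynomial F, IsMinPolyOf F c p → SplitsIn h p

/-- `K` is a (commutative) subfield of the subring `A`. -/
def IsSubfieldOf {R : Type*} [Ring R] (A K : Subring R) : Prop :=
  K ≤ A ∧ (∀ x ∈ K, ∀ y ∈ K, x * y = y * x) ∧
    ∀ x ∈ K, x ≠ 0 → ∃ y ∈ K, x * y = 1 ∧ y * x = 1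

/-- `K` is a maximal subfield of the subring `A`. -/
def IsMaxSubfieldOf {R : Type*} [Ring R] (A K : Subring R) : Prop :=
  IsSubfieldOf A K ∧ ∀ K' : Subring R, IsSubfieldOf A K' → K ≤ K' → K' = K

/-- `T` is a maximal graded subfield of the graded subring `A`. -/
def IsMaxGradedSubfieldOf (𝒜 : Γ → AddSubgroup D) [GradedRing 𝒜] (A T : Subring D) : Prop :=
  IsGradedSubfield 𝒜 T ∧ T ≤ A ∧
    ∀ T' : Subring D, IsGradedSubfield 𝒜 T' → T' ≤ A → T ≤ T' → T' = T

/-- The canonical subalgebra `𝖴 = 𝖣₀ ⊗_{𝖥₀} 𝖥`: the subring generated by `𝖣₀` and `𝖥`. -/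
def Uc (𝒜 : Γ → AddSubgroup D) [GradedRing 𝒜] (F : Subring D) : Subring D :=
  grade0 𝒜 ⊔ F

/-- The canonical subalgebra `𝖹 = Z(𝖣₀) ⊗_{𝖥₀} 𝖥`: the subring generated by the center
of `𝖣₀` and `𝖥`. -/
def Zc (𝒜 : Γ → AddSubgroup D) [GradedRing 𝒜] (F : Subring D) : Subring D :=
  (Subring.centralizer (grade0 𝒜 : Set D) ⊓ grade0 𝒜) ⊔ F

/-- The canonical subalgebra `𝖢 = C_𝖣(𝖴)`. -/
def Cc (𝒜 : Γ → AddSubgroup D) [GradedRing 𝒜] (F : Subring D) : Subring D :=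
  Subring.centralizer (Uc 𝒜 F : Set D)

/-- The canonical subalgebra `𝖤 = C_𝖣(𝖹)`. -/
def Ec (𝒜 : Γ → AddSubgroup D) [GradedRing 𝒜] (F : Subring D) : Subring D :=
  Subring.centralizer (Zc 𝒜 F : Set D)

end GradedDivPaper

namespace GradedDivPaper

section Components

variable {Γ : Type*} [AddCommGroup Γ] [DecidableEq Γ] {D : Type*} [Ring D]
  (𝒜 : Γ → AddSubgroup D) [GradedRing 𝒜]

theorem proj_mem (γ : Γ) (x : D) : GradedRing.proj 𝒜 γ x ∈ 𝒜 γ :=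
  (DirectSum.decompose 𝒜 x γ).2

theorem proj_of_mem {γ : Γ} {x : D} (hx : x ∈ 𝒜 γ) : GradedRing.proj 𝒜 γ x = x :=
  DirectSum.decompose_of_mem_same 𝒜 hx

theorem proj_of_mem_ne {γ δ : Γ} {x : D} (hx : x ∈ 𝒜 γ) (h : γ ≠ δ) :
    GradedRing.proj 𝒜 δ x = 0 :=
  DirectSum.decompose_of_mem_ne 𝒜 hx h

theorem proj_mul_left {γ : Γ} {a : D} (ha : a ∈ 𝒜 γ) (δ : Γ) (x : D) :
    GradedRing.proj 𝒜 δ (a * x) = a * GradedRing.proj 𝒜 (δ - γ) x := by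
  have := DirectSum.coe_decompose_mul_add_of_left_mem (j := δ - γ) (b := x) 𝒜 ha
  rwa [add_sub_cancel] at this

theorem proj_mul_right {γ : Γ} {a : D} (ha : a ∈ 𝒜 γ) (δ : Γ) (x : D) :
    GradedRing.proj 𝒜 δ (x * a) = GradedRing.proj 𝒜 (δ - γ) x * a := by
  have := DirectSum.coe_decompose_mul_add_of_right_mem (i := δ - γ) (a := x) 𝒜 ha
  rwa [sub_add_cancel] at this

theorem exists_eq_sum_proj (x : D) :
    ∃ s : Finset Γ, x = ∑ γ ∈ s, GradedRing.proj 𝒜 γ x ∧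
      ∀ γ, γ ∉ s → GradedRing.proj 𝒜 γ x = 0 := by
  classical
  refine ⟨(DirectSum.decompose 𝒜 x).support,
    (DirectSum.sum_support_decompose 𝒜 x).symm, fun γ hγ => ?_⟩
  simpa [GradedRing.proj_apply] using hγ

theorem eq_of_proj_eq {x y : D} (h : ∀ γ, GradedRing.proj 𝒜 γ x = GradedRing.proj 𝒜 γ y) :
    x = y := by
  apply (DirectSum.decompose 𝒜).injective
  ext γ
  exact h γ

theorem mem_of_proj_mem {E : Subring D} {x : D} (h : ∀ γ, GradedRing.proj 𝒜 γ x ∈ E) :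
    x ∈ E := by
  obtain ⟨s, hs, -⟩ := exists_eq_sum_proj 𝒜 x
  rw [hs]
  exact E.sum_mem fun γ _ => h γ

theorem exists_proj_ne_zero {x : D} (hx : x ≠ 0) : ∃ γ, GradedRing.proj 𝒜 γ x ≠ 0 := by
  by_contra! h
  exact hx (eq_of_proj_eq 𝒜 fun γ => by rw [h γ, map_zero])

theorem mul_mem_grade {γ δ : Γ} {x y : D} (hx : x ∈ 𝒜 γ) (hy : y ∈ 𝒜 δ) :
    x * y ∈ 𝒜 (γ + δ) :=
  SetLike.mul_mem_graded hx hy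

theorem pow_mem_grade {γ : Γ} {x : D} (hx : x ∈ 𝒜 γ) (n : ℕ) : x ^ n ∈ 𝒜 (n • γ) :=
  SetLike.pow_mem_graded n hx

variable {𝒜}

theorem IsGradedDivisionRing.exists_inv (hD : IsGradedDivisionRing 𝒜) {γ : Γ} {x : D}
    (hx : x ∈ 𝒜 γ) (h0 : x ≠ 0) : ∃ y ∈ 𝒜 (-γ), x * y = 1 ∧ y * x = 1 := by
  obtain ⟨u, rfl⟩ := hD.2 γ x hx h0
  refine ⟨↑u⁻¹, ?_, u.mul_inv, u.inv_mul⟩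
  have h1 : (u : D) * GradedRing.proj 𝒜 (-γ) (↑u⁻¹ : D) = 1 := by
    have := proj_mul_left 𝒜 hx 0 (↑u⁻¹ : D)
    rw [u.mul_inv, proj_of_mem 𝒜 (SetLike.one_mem_graded 𝒜), zero_sub] at this
    exact this.symm
  rw [Units.inv_eq_of_mul_eq_one_right h1]
  exact proj_mem 𝒜 _ _

theorem IsGradedDivisionRing.mem_inv (hD : IsGradedDivisionRing 𝒜) {γ : Γ} {x y : D}
    (hx : x ∈ 𝒜 γ) (hxy : x * y = 1) : y ∈ 𝒜 (-γ) := by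
  have h0 : x ≠ 0 := by
    rintro rfl
    exact hD.1 (by simpa using hxy)
  obtain ⟨z, hz, -, hzx⟩ := hD.exists_inv hx h0
  have : y = z := by
    calc y = z * x * y := by rw [hzx, one_mul]
    _ = z := by rw [mul_assoc, hxy, mul_one]
  rwa [this]

theorem ne_zero_of_mul_eq_one (hD : IsGradedDivisionRing 𝒜) {x y : D} (h : x * y = 1) :
    x ≠ 0 := by
  rintro rfl
  exact hD.1 (by simpa using h)

theorem IsGradedSubring.proj_mem {E : Subring D} (hE : IsGradedSubring 𝒜 E) {x : D}
    (hx : x ∈ E) (γ : Γ) : GradedRing.proj 𝒜 γ x ∈ E := hE x hx γ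

theorem mem_centralizer_of_commute_homogeneous {E : Subring D} (hE : IsGradedSubring 𝒜 E)
    {x : D} (h : ∀ γ, ∀ e ∈ E, e ∈ 𝒜 γ → e * x = x * e) :
    x ∈ Subring.centralizer (E : Set D) := by
  rw [Subring.mem_centralizer_iff]
  intro e he
  obtain ⟨s, hs, -⟩ := exists_eq_sum_proj 𝒜 e
  rw [hs, Finset.sum_mul, Finset.mul_sum]
  exact Finset.sum_congr rfl fun γ _ => h γ _ (hE.proj_mem he γ) (proj_mem 𝒜 γ e)

theorem inv_mem_centralizer {S : Set D} {x y : D} (hx : x ∈ Subring.centralizer S)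
    (hxy : x * y = 1) (hyx : y * x = 1) : y ∈ Subring.centralizer S := by
  rw [Subring.mem_centralizer_iff] at *
  intro s hs
  calc s * y = y * x * (s * y) := by rw [hyx, one_mul]
    _ = y * (s * x) * y := by rw [hx s hs]; simp only [mul_assoc]
    _ = y * s := by simp only [mul_assoc, hxy, mul_one]

theorem isGradedDivSubring_centralizer_of_homogeneous (hD : IsGradedDivisionRing 𝒜) {S : Set D}
    (hS : ∀ s ∈ S, ∃ γ, s ∈ 𝒜 γ) : IsGradedDivSubring 𝒜 (Subring.centralizer S) := by
  refine ⟨fun x hx γ => ?_, fun γ x hx hxγ h0 => ?_⟩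
  · change GradedRing.proj 𝒜 γ x ∈ _
    rw [Subring.mem_centralizer_iff] at *
    intro s hs
    obtain ⟨δ, hδ⟩ := hS s hs
    have h1 := proj_mul_left 𝒜 hδ (γ + δ) x
    have h2 := proj_mul_right 𝒜 hδ (γ + δ) x
    rw [add_sub_cancel_right] at h1 h2
    rw [← h1, ← h2, hx s hs]
  · obtain ⟨y, -, hxy, hyx⟩ := hD.exists_inv hxγ h0
    exact ⟨y, inv_mem_centralizer hx hxy hyx, hxy, hyx⟩

theorem isGradedDivSubring_centralizer (hD : IsGradedDivisionRing 𝒜) {E : Subring D}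
    (hE : IsGradedSubring 𝒜 E) : IsGradedDivSubring 𝒜 (Subring.centralizer (E : Set D)) := by
  have : Subring.centralizer (E : Set D) =
      Subring.centralizer {e : D | e ∈ E ∧ ∃ γ, e ∈ 𝒜 γ} := by
    refine le_antisymm (Subring.centralizer_le _ _ fun e he => he.1) fun x hx => ?_
    exact mem_centralizer_of_commute_homogeneous hE fun γ e he hγ =>
      Subring.mem_centralizer_iff.1 hx e ⟨he, γ, hγ⟩
  rw [this]
  exact isGradedDivSubring_centralizer_of_homogeneous hD fun s hs => hs.2

theorem IsGradedDivSubring.inf {E E' : Subring D}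
    (h : IsGradedDivSubring 𝒜 E) (h' : IsGradedDivSubring 𝒜 E') :
    IsGradedDivSubring 𝒜 (E ⊓ E') := by
  refine ⟨fun x hx γ => ⟨h.1 x hx.1 γ, h'.1 x hx.2 γ⟩, fun γ x hx hγ h0 => ?_⟩
  obtain ⟨y, hy, hxy, hyx⟩ := h.2 γ x hx.1 hγ h0
  obtain ⟨z, hz, -, hzx⟩ := h'.2 γ x hx.2 hγ h0
  have : y = z := by
    calc y = z * x * y := by rw [hzx, one_mul]
    _ = z := by rw [mul_assoc, hxy, mul_one]
  exact ⟨y, ⟨hy, this ▸ hz⟩, hxy, hyx⟩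

theorem IsGradedDivSubring.inv_mem {E : Subring D} (h : IsGradedDivSubring 𝒜 E)
    (hD : IsGradedDivisionRing 𝒜) {γ : Γ} {x y : D}
    (hx : x ∈ E) (hγ : x ∈ 𝒜 γ) (hxy : x * y = 1) : y ∈ E := by
  obtain ⟨z, hz, -, hzx⟩ := h.2 γ x hx hγ (ne_zero_of_mul_eq_one hD hxy)
  have : y = z := by
    calc y = z * x * y := by rw [hzx, one_mul]
    _ = z := by rw [mul_assoc, hxy, mul_one]
  exact this ▸ hz

theorem isGradedSubring_top : IsGradedSubring 𝒜 (⊤ : Subring D) := fun _ _ _ => trivial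

theorem isGradedDivSubring_top (hD : IsGradedDivisionRing 𝒜) :
    IsGradedDivSubring 𝒜 (⊤ : Subring D) := by
  refine ⟨isGradedSubring_top, fun γ x _ hγ h0 => ?_⟩
  obtain ⟨y, -, h⟩ := hD.exists_inv hγ h0
  exact ⟨y, trivial, h⟩

theorem isGradedDivSubring_center (hD : IsGradedDivisionRing 𝒜) :
    IsGradedDivSubring 𝒜 (Subring.center D) := by
  have := isGradedDivSubring_centralizer hD (isGradedSubring_top (𝒜 := 𝒜))
  rwa [Subring.coe_top, Subring.centralizer_univ] at this

variable (𝒜) in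
theorem isGradedDivSubring_Cc (hD : IsGradedDivisionRing 𝒜) {F : Subring D}
    (hF : F = Subring.center D) : IsGradedDivSubring 𝒜 (Cc 𝒜 F) := by
  have : Cc 𝒜 F = Subring.centralizer (grade0 𝒜 : Set D) := by
    refine le_antisymm (Subring.centralizer_le _ _ ?_) fun x hx => ?_
    · exact SetLike.coe_subset_coe.2 (le_sup_left : grade0 𝒜 ≤ grade0 𝒜 ⊔ F)
    · rw [Cc, Subring.mem_centralizer_iff]
      have : Uc 𝒜 F ≤ Subring.centralizer {x} := by
        refine sup_le (fun y hy => ?_) (fun y hy => ?_)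
        · rw [Subring.mem_centralizer_iff]
          rintro _ rfl
          exact (Subring.mem_centralizer_iff.1 hx y hy).symm
        · rw [hF] at hy
          exact Subring.center_le_centralizer _ hy
      intro y hy
      exact (Subring.mem_centralizer_iff.1 (this hy) x rfl).symm
  rw [this]
  exact isGradedDivSubring_centralizer_of_homogeneous hD fun s hs => ⟨0, hs⟩

/-- A maximal graded subfield of a graded division subring is its own centralizer there. -/
theorem IsMaxGradedSubfieldOf.mem_of_commute (hD : IsGradedDivisionRing 𝒜) {A T : Subring D}
    (hA : IsGradedDivSubring 𝒜 A) (hT : IsMaxGradedSubfieldOf 𝒜 A T) {x : D} (hx : x ∈ A)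
    (hxT : x ∈ Subring.centralizer (T : Set D)) : x ∈ T := by
  have homog : ∀ γ, ∀ x ∈ A, x ∈ 𝒜 γ → x ∈ Subring.centralizer (T : Set D) → x ∈ T := by
    intro γ x hx hγ hxT
    have hTgr : IsGradedSubring 𝒜 T := hT.1.1.1
    set C := Subring.centralizer (T : Set D) ⊓ Subring.centralizer {x} with hC
    have hCgr : IsGradedDivSubring 𝒜 C :=
      (isGradedDivSubring_centralizer hD hTgr).inf
        (isGradedDivSubring_centralizer_of_homogeneous hD (by rintro s rfl; exact ⟨γ, hγ⟩))
    have hTC : T ≤ C := fun t ht => by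
      refine ⟨Subring.mem_centralizer_iff.2 fun s hs => hT.1.2 s hs t ht,
        Subring.mem_centralizer_iff.2 ?_⟩
      rintro _ rfl
      exact (Subring.mem_centralizer_iff.1 hxT t ht).symm
    have hxC : x ∈ C := ⟨hxT, Subring.mem_centralizer_iff.2 (by rintro _ rfl; rfl)⟩
    set K := Subring.centralizer (C : Set D) with hK
    have hTK : T ≤ K := fun t ht => Subring.mem_centralizer_iff.2 fun c hc =>
      (Subring.mem_centralizer_iff.1 hc.1 t ht).symm
    have hxK : x ∈ K := Subring.mem_centralizer_iff.2 fun c hc =>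
      (Subring.mem_centralizer_iff.1 hc.2 x rfl).symm
    have hKC : K ≤ C := by
      intro k hk
      rw [hK, Subring.mem_centralizer_iff] at hk
      refine ⟨Subring.mem_centralizer_iff.2 fun t ht => hk t (hTC ht),
        Subring.mem_centralizer_iff.2 ?_⟩
      rintro _ rfl
      exact hk _ hxC
    have hmax := hT.2.2 (K ⊓ A)
      ⟨(isGradedDivSubring_centralizer hD hCgr.1).inf hA, fun a ha b hb =>
        (Subring.mem_centralizer_iff.1 hb.1 a (hKC ha.1))⟩ inf_le_right
      (le_inf hTK hT.2.1)
    rw [← hmax]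
    exact ⟨hxK, hx⟩
  refine mem_of_proj_mem 𝒜 fun γ => homog γ _ (hA.1.proj_mem hx γ) (proj_mem 𝒜 γ x) ?_
  exact (isGradedDivSubring_centralizer hD hT.1.1.1).1 x hxT γ

end Components

/-- A torsion-free abelian group has a translation-invariant linear order. -/
theorem TorsionFree.exists_linearOrder {Γ : Type*} [AddCommGroup Γ] (hΓ : TorsionFree Γ) :
    ∃ _ : LinearOrder Γ, IsOrderedAddMonoid Γ := by
  classical
  have : IsAddTorsionFree Γ := by
    rw [isAddTorsionFree_iff_not_isOfFinAddOrder]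
    intro a ha hfin
    obtain ⟨n, hn, h⟩ := isOfFinAddOrder_iff_nsmul_eq_zero.1 hfin
    exact ha (hΓ a n hn.ne' h)
  let b := Module.Basis.ofVectorSpace ℚ (DivisibleHull Γ)
  let : LinearOrder (Module.Basis.ofVectorSpaceIndex ℚ (DivisibleHull Γ)) :=
    linearOrderOfSTO WellOrderingRel
  let v : Γ → Lex (Module.Basis.ofVectorSpaceIndex ℚ (DivisibleHull Γ) →₀ ℚ) :=
    fun γ => toLex (b.repr (DivisibleHull.coeAddMonoidHom Γ γ))
  have hv : Function.Injective v := fun x y h =>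
    DivisibleHull.coe_injective (b.repr.injective (toLex.injective h))
  have hadd : ∀ x y, v (x + y) = v x + v y := fun x y => by simp only [v, map_add]; rfl
  have hle : ∀ a b c, v a ≤ v b → v (a + c) ≤ v (b + c) := fun a b c h => by
    rw [hadd, hadd]
    exact add_le_add_left h _
  exact ⟨LinearOrder.lift' v hv, @IsOrderedAddMonoid.mk Γ _
    (LinearOrder.lift' v hv).toPartialOrder.toPreorder (fun a b h c => hle a b c h)
    fun a b h c => by rw [add_comm c, add_comm c]; exact hle a b c h⟩

section Ordered

variable {Γ : Type*} [AddCommGroup Γ] [DecidableEq Γ] {D : Type*} [Ring D]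
  (𝒜 : Γ → AddSubgroup D) [GradedRing 𝒜]

theorem proj_mul_of_le [LinearOrder Γ] [IsOrderedAddMonoid Γ] {x y : D} {a b δ : Γ}
    (hx : ∀ γ, a < γ → GradedRing.proj 𝒜 γ x = 0) (hy : ∀ γ, b < γ → GradedRing.proj 𝒜 γ y = 0)
    (h : a + b ≤ δ) :
    GradedRing.proj 𝒜 δ (x * y) = GradedRing.proj 𝒜 a x * GradedRing.proj 𝒜 (δ - a) y := by
  obtain ⟨s, hs, hs'⟩ := exists_eq_sum_proj 𝒜 x
  conv_lhs => rw [hs]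
  rw [Finset.sum_mul, map_sum]
  simp_rw [proj_mul_left 𝒜 (proj_mem 𝒜 _ x)]
  refine Finset.sum_eq_single a (fun γ _ hγ => ?_) (fun ha => by rw [hs' a ha, zero_mul])
  rcases lt_or_gt_of_ne hγ with h1 | h1
  · rw [hy, mul_zero]
    rw [lt_sub_iff_add_lt]
    calc b + γ < b + a := by gcongr
      _ ≤ δ := by rwa [add_comm]
  · rw [hx γ h1, zero_mul]

theorem exists_top_degree [LinearOrder Γ] {x : D} (hx : x ≠ 0) :
    ∃ a, GradedRing.proj 𝒜 a x ≠ 0 ∧ ∀ γ, a < γ → GradedRing.proj 𝒜 γ x = 0 := by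
  classical
  obtain ⟨s, -, hs⟩ := exists_eq_sum_proj 𝒜 x
  obtain ⟨γ, hγ⟩ := exists_proj_ne_zero 𝒜 hx
  have hne : (s.filter fun γ => GradedRing.proj 𝒜 γ x ≠ 0).Nonempty :=
    ⟨γ, Finset.mem_filter.2 ⟨by_contra fun h => hγ (hs γ h), hγ⟩⟩
  refine ⟨_, (Finset.mem_filter.1 (Finset.max'_mem _ hne)).2, fun δ hδ => ?_⟩
  by_contra h0
  exact absurd hδ (not_lt.2 (Finset.le_max' _ δ
    (Finset.mem_filter.2 ⟨by_contra fun h => h0 (hs δ h), h0⟩)))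

variable {𝒜}

theorem IsGradedDivisionRing.noZeroDivisors (hD : IsGradedDivisionRing 𝒜) (hΓ : TorsionFree Γ) :
    NoZeroDivisors D := by
  obtain ⟨_, _⟩ := hΓ.exists_linearOrder
  refine ⟨fun {x y} h => ?_⟩
  by_contra! h0
  obtain ⟨a, ha, ha'⟩ := exists_top_degree 𝒜 h0.1
  obtain ⟨b, hb, hb'⟩ := exists_top_degree 𝒜 h0.2
  have := proj_mul_of_le 𝒜 ha' hb' le_rfl
  rw [h, map_zero, add_sub_cancel_left] at this
  exact hb ((hD.2 a _ (proj_mem 𝒜 a x) ha).mul_right_eq_zero.1 this.symm)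

theorem proj_pow_of_le [LinearOrder Γ] [IsOrderedAddMonoid Γ] {x : D} {a : Γ}
    (hx : ∀ γ, a < γ → GradedRing.proj 𝒜 γ x = 0) (n : ℕ) :
    GradedRing.proj 𝒜 (n • a) (x ^ n) = GradedRing.proj 𝒜 a x ^ n ∧
      ∀ γ, n • a < γ → GradedRing.proj 𝒜 γ (x ^ n) = 0 := by
  induction n with
  | zero =>
    refine ⟨by simpa using proj_of_mem 𝒜 (SetLike.one_mem_graded 𝒜), fun γ h => ?_⟩
    rw [pow_zero]
    exact proj_of_mem_ne 𝒜 (SetLike.one_mem_graded 𝒜) (by simpa using h.ne)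
  | succ n ih =>
    rw [pow_succ', pow_succ', succ_nsmul', ← ih.1]
    refine ⟨?_, fun γ h => ?_⟩
    · rw [proj_mul_of_le 𝒜 hx ih.2 le_rfl, add_sub_cancel_left]
    · rw [proj_mul_of_le 𝒜 hx ih.2 h.le, ih.2, mul_zero]
      rwa [lt_sub_iff_add_lt, add_comm]

theorem proj_eq_zero_of_integral_of_pos [LinearOrder Γ] [IsOrderedAddMonoid Γ]
    (hD : IsGradedDivisionRing 𝒜) {u : D} {n : ℕ} {b : ℕ → D} (hb : ∀ i, b i ∈ 𝒜 0)
    (h : ∑ i ∈ Finset.range n, b i * u ^ i + u ^ n = 0) {γ : Γ} (hγ : 0 < γ) :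
    GradedRing.proj 𝒜 γ u = 0 := by
  by_contra h0
  obtain ⟨a, ha, ha'⟩ := exists_top_degree 𝒜 (x := u) (by rintro rfl; simp at h0)
  have hpos : 0 < a := by
    by_contra h1
    exact h0 (ha' γ ((not_lt.1 h1).trans_lt hγ))
  have h2 := congrArg (GradedRing.proj 𝒜 (n • a)) h
  rw [map_add, map_sum, map_zero, (proj_pow_of_le ha' n).1, Finset.sum_eq_zero, zero_add] at h2
  · have hu := (hD.2 a _ (proj_mem 𝒜 a u) ha).pow n
    rw [h2] at hu
    exact hD.1 (isUnit_zero_iff.1 hu)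
  · intro i hi
    rw [proj_mul_left 𝒜 (hb i), sub_zero, (proj_pow_of_le ha' i).2, mul_zero]
    exact nsmul_lt_nsmul_left hpos (Finset.mem_range.1 hi)

/-- An element integral over the degree-zero part has degree zero. -/
theorem mem_grade_zero_of_integral (hΓ : TorsionFree Γ) (hD : IsGradedDivisionRing 𝒜) {u : D}
    {n : ℕ} {b : ℕ → D} (hb : ∀ i, b i ∈ 𝒜 0)
    (h : ∑ i ∈ Finset.range n, b i * u ^ i + u ^ n = 0) : u ∈ 𝒜 0 := by
  obtain ⟨o, ho⟩ := hΓ.exists_linearOrder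
  have key : ∀ γ, γ ≠ 0 → GradedRing.proj 𝒜 γ u = 0 := by
    intro γ hγ
    rcases lt_or_gt_of_ne hγ with h1 | h1
    · obtain ⟨o', hle⟩ : ∃ o' : LinearOrder Γ, ∀ x y, o'.le x y ↔ o.le y x :=
        ⟨LinearOrder.lift' (fun x : Γ => -x) neg_injective, fun x y => neg_le_neg_iff⟩
      have ho' : @IsOrderedAddMonoid Γ _ o'.toPartialOrder.toPreorder :=
        @IsOrderedAddMonoid.mk Γ _ o'.toPartialOrder.toPreorder
          (fun a b h c => (hle _ _).2 (ho.add_le_add_left _ _ ((hle _ _).1 h) c))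
          (fun a b h c => (hle _ _).2 (ho.add_le_add_right _ _ ((hle _ _).1 h) c))
      refine @proj_eq_zero_of_integral_of_pos _ _ _ _ _ _ _ o' ho' hD _ _ _ hb h γ ?_
      exact (@not_le _ o' _ _).1 fun h2 => (@not_le _ o _ _).2 h1 ((hle _ _).1 h2)
    · exact proj_eq_zero_of_integral_of_pos hD hb h h1
  have : u = GradedRing.proj 𝒜 0 u := by
    refine eq_of_proj_eq 𝒜 fun γ => ?_
    rcases eq_or_ne γ 0 with rfl | hγ
    · rw [proj_of_mem 𝒜 (proj_mem 𝒜 0 u)]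
    · rw [key γ hγ, proj_of_mem_ne 𝒜 (proj_mem 𝒜 0 u) hγ.symm]
  rw [this]
  exact proj_mem 𝒜 0 u

end Ordered

section MinPoly

open Polynomial

variable {Γ : Type*} [AddCommGroup Γ] [DecidableEq Γ] {D : Type*} [Ring D]
  {𝒜 : Γ → AddSubgroup D} [GradedRing 𝒜] {F : Subring D}

/-- A polynomial relation satisfied by a homogeneous element can be replaced by a monic homogeneous
one of the same degree. -/
theorem exists_monic_homogeneous (hD : IsGradedDivisionRing 𝒜) (hF : IsGradedDivSubring 𝒜 F)
    {γ : Γ} {c : D} (hc : c ∈ 𝒜 γ) {q : Polynomial F} (hq : q ≠ 0)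
    (hqc : eval₂ F.subtype c q = 0) :
    ∃ q' : Polynomial F, q'.Monic ∧ q'.natDegree = q.natDegree ∧ eval₂ F.subtype c q' = 0 ∧
      ∀ i, (q'.coeff i : D) ∈ 𝒜 ((q.natDegree - i) • γ) := by
  have : Nontrivial F := ⟨0, 1, fun h => hD.1 (congrArg Subtype.val h)⟩
  set n := q.natDegree with hn
  have hlead : (q.coeff n : D) ≠ 0 := fun h =>
    hq (leadingCoeff_eq_zero.1 (Subtype.ext h))
  obtain ⟨δ, hδ⟩ := exists_proj_ne_zero 𝒜 hlead
  obtain ⟨e, he, hmul, hemul⟩ := hF.2 δ _ (hF.1.proj_mem (q.coeff n).2 δ) (proj_mem 𝒜 δ _) hδ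
  have heδ : e ∈ 𝒜 (-δ) := hD.mem_inv (proj_mem 𝒜 δ _) hmul
  let a : ℕ → F := fun i => if i ≤ n then
    ⟨e * GradedRing.proj 𝒜 (δ + (n - i) • γ) (q.coeff i),
      F.mul_mem he (hF.1.proj_mem (q.coeff i).2 _)⟩ else 0
  have han : a n = 1 := by
    apply Subtype.ext
    simp only [a]
    rw [if_pos le_rfl]
    change e * _ = 1
    rw [Nat.sub_self, zero_nsmul, add_zero]
    exact hemul
  let q' : Polynomial F := ∑ i ∈ Finset.range (n + 1), monomial i (a i)
  have hcoeff : ∀ i, q'.coeff i = a i := fun i => by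
    simp only [q', finsetSum_coeff, coeff_monomial, Finset.sum_ite_eq', Finset.mem_range]
    split_ifs with h
    · rfl
    · simp only [a]
      rw [if_neg (by omega)]
  have hdeg : q'.natDegree ≤ n := by
    rw [natDegree_le_iff_coeff_eq_zero]
    intro N hN
    rw [hcoeff]
    exact if_neg (by omega)
  refine ⟨q', monic_of_natDegree_le_of_coeff_eq_one n hdeg (by rw [hcoeff, han]),
    le_antisymm hdeg (le_natDegree_of_ne_zero (by rw [hcoeff, han]; exact one_ne_zero)), ?_, ?_⟩
  · have h1 : eval₂ F.subtype c q' =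
        e * GradedRing.proj 𝒜 (δ + n • γ) (eval₂ F.subtype c q) := by
      change eval₂ F.subtype c (∑ i ∈ Finset.range (n + 1), monomial i (a i)) = _
      rw [eval₂_eq_sum_range (p := q), map_sum, Finset.mul_sum, ← hn, eval₂_finsetSum]
      refine Finset.sum_congr rfl fun i hi => ?_
      have hi' : i ≤ n := by simpa [Nat.lt_succ_iff] using hi
      rw [eval₂_monomial, proj_mul_right 𝒜 (pow_mem_grade 𝒜 hc i), ← mul_assoc]
      simp only [a, if_pos hi', Subring.subtype_apply]
      rw [sub_nsmul _ hi', add_sub_assoc, sub_eq_add_neg (n • γ)]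
    rw [h1, hqc, map_zero, mul_zero]
  · intro i
    rw [hcoeff]
    simp only [a]
    split_ifs with h
    · have := mul_mem_grade 𝒜 heδ (proj_mem 𝒜 (δ + (n - i) • γ) (q.coeff i : D))
      rwa [neg_add_cancel_left] at this
    · exact (𝒜 _).zero_mem

theorem IsMinPolyOf.natDegree_le (hD : IsGradedDivisionRing 𝒜) (hF : IsGradedDivSubring 𝒜 F)
    {γ : Γ} {c : D} (hc : c ∈ 𝒜 γ) {p : Polynomial F} (hp : IsMinPolyOf F c p)
    {q : Polynomial F} (hq : q ≠ 0) (hqc : eval₂ F.subtype c q = 0) :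
    p.natDegree ≤ q.natDegree := by
  obtain ⟨q', hmon, hdeg, hev, -⟩ := exists_monic_homogeneous hD hF hc hq hqc
  rw [← hdeg]
  exact natDegree_le_natDegree (hp.2.2 q' hmon hev)

theorem eval₂_mul_of_central (hF : F ≤ Subring.center D) (c : D) (p q : Polynomial F) :
    eval₂ F.subtype c (p * q) = eval₂ F.subtype c p * eval₂ F.subtype c q :=
  eval₂_mul_noncomm _ _ fun k => ((Subring.mem_center_iff.1 (hF (q.coeff k).2)) c).symm

/-- A root of the minimal polynomial of a homogeneous element satisfies all the polynomial
relations of that element. -/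
theorem IsMinPolyOf.eval₂_eq_zero (hD : IsGradedDivisionRing 𝒜) (hF : IsGradedDivSubring 𝒜 F)
    (hcen : F ≤ Subring.center D) {γ : Γ} {c r : D} (hc : c ∈ 𝒜 γ) {p : Polynomial F}
    (hp : IsMinPolyOf F c p) (hr : eval₂ F.subtype r p = 0) {q : Polynomial F}
    (hqc : eval₂ F.subtype c q = 0) : eval₂ F.subtype r q = 0 := by
  have : Nontrivial F := ⟨0, 1, fun h => hD.1 (congrArg Subtype.val h)⟩
  have hdiv := modByMonic_add_div q p
  have hrem : eval₂ F.subtype c (q %ₘ p) = 0 := by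
    have h := congrArg (eval₂ F.subtype c) hdiv
    rwa [eval₂_add, eval₂_mul_of_central hcen, hp.2.1, zero_mul, add_zero, hqc] at h
  have hzero : q %ₘ p = 0 := by
    by_contra h0
    have h1 := hp.natDegree_le hD hF hc h0 hrem
    have h2 := natDegree_lt_natDegree h0 (degree_modByMonic_lt q hp.1)
    omega
  rw [← hdiv, hzero, zero_add, eval₂_mul_of_central hcen, hr, zero_mul]

theorem exists_monic_eval₂_eq_zero (hFcen : F = Subring.center D) (hfin : finiteOver F) (c : D) :
    ∃ q : Polynomial F, q.Monic ∧ eval₂ F.subtype c q = 0 := by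
  subst hFcen
  have : Module.Finite (Subring.center D) D := hfin
  exact IsIntegral.of_finite (Subring.center D) c

theorem exists_isMinPolyOf [Nontrivial F] (hFcen : F = Subring.center D) (hfin : finiteOver F)
    (c : D) : ∃ p : Polynomial F, IsMinPolyOf F c p := by
  obtain ⟨q, hq⟩ := exists_monic_eval₂_eq_zero hFcen hfin c
  obtain ⟨p, hp, hmin⟩ := WellFounded.has_min (measure (fun p : Polynomial F => p.natDegree)).wf
    {q : Polynomial F | q.Monic ∧ eval₂ F.subtype c q = 0} ⟨q, hq⟩
  refine ⟨p, hp.1, hp.2, fun q hq hqc => ?_⟩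
  rw [degree_eq_natDegree hp.1.ne_zero, degree_eq_natDegree hq.ne_zero]
  exact_mod_cast not_lt.1 (hmin q ⟨hq, hqc⟩)

/-- A conjugate of a homogeneous element is homogeneous of the same degree. -/
theorem mem_grade_of_conjugate (hΓ : TorsionFree Γ) (hD : IsGradedDivisionRing 𝒜)
    (hF : IsGradedDivSubring 𝒜 F) (hFcen : F = Subring.center D) (hfin : finiteOver F)
    {γ : Γ} {c r : D} (hc : c ∈ 𝒜 γ) (hcr : Commute c r)
    (h : ∀ q : Polynomial F, eval₂ F.subtype c q = 0 → eval₂ F.subtype r q = 0) :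
    r ∈ 𝒜 γ := by
  by_cases hc0 : c = 0
  · have := h X (by rw [eval₂_X, hc0])
    rw [eval₂_X] at this
    rw [this]
    exact (𝒜 γ).zero_mem
  have : Nontrivial F := ⟨0, 1, fun h => hD.1 (congrArg Subtype.val h)⟩
  obtain ⟨q₀, hq₀, hq₀c⟩ := exists_monic_eval₂_eq_zero hFcen hfin c
  obtain ⟨q, hq, hdeg, hqc, hqh⟩ := exists_monic_homogeneous hD hF hc hq₀.ne_zero hq₀c
  rw [← hdeg] at hqh
  obtain ⟨e, he, hce, hec⟩ := hD.exists_inv hc hc0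
  have her : Commute e r := by
    change e * r = r * e
    calc e * r = e * (r * c) * e := by rw [mul_assoc, mul_assoc, hce, mul_one]
      _ = e * (c * r) * e := by rw [hcr.eq]
      _ = r * e := by rw [← mul_assoc, hec, one_mul]
  set n := q.natDegree with hn
  have hterm : ∀ i ≤ n, e ^ (n - i) * (r * e) ^ i = r ^ i * e ^ n := fun i hi => by
    rw [her.symm.mul_pow, ← mul_assoc, ((her.pow_left _).pow_right _).eq, mul_assoc, ← pow_add,
      Nat.sub_add_cancel hi]
  have hu : r * e ∈ 𝒜 0 := by
    refine mem_grade_zero_of_integral hΓ hD (n := n)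
      (b := fun i => (q.coeff i : D) * e ^ (n - i)) (fun i => ?_) ?_
    · have := mul_mem_grade 𝒜 (hqh i) (pow_mem_grade 𝒜 he (n - i))
      rwa [smul_neg, add_neg_cancel] at this
    · have hr := h q hqc
      rw [eval₂_eq_sum_range, Finset.sum_range_succ, ← hn, hq.coeff_natDegree, map_one,
        one_mul] at hr
      have : ∀ i ∈ Finset.range n, (q.coeff i : D) * e ^ (n - i) * (r * e) ^ i =
          F.subtype (q.coeff i) * r ^ i * e ^ n := fun i hi => by
        rw [mul_assoc, hterm i (Finset.mem_range.1 hi).le, mul_assoc]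
        rfl
      have h2 := hterm n le_rfl
      rw [Nat.sub_self, pow_zero, one_mul] at h2
      rw [Finset.sum_congr rfl this, ← Finset.sum_mul, h2, ← add_mul, hr, zero_mul]
  have := mul_mem_grade 𝒜 hu hc
  rwa [mul_assoc, hec, mul_one, zero_add] at this

end MinPoly

section Finiteness

variable {Γ : Type*} [AddCommGroup Γ] [DecidableEq Γ] {D : Type*} [Ring D]
  {𝒜 : Γ → AddSubgroup D} [GradedRing 𝒜] {F : Subring D}

/-- The degrees occurring in `D` form finitely many classes modulo the degrees of its center. -/
theorem exists_finite_degrees (hΓ : TorsionFree Γ) (hD : IsGradedDivisionRing 𝒜)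
    (hF : IsGradedDivSubring 𝒜 F) (hfin : finiteOver F) :
    ∃ s : Finset Γ, ∀ γ, ∀ x ∈ 𝒜 γ, x ≠ 0 → ∃ δ ∈ s, ∃ f ∈ F, f ≠ 0 ∧ f ∈ 𝒜 (γ - δ) := by
  have := hD.noZeroDivisors hΓ
  obtain ⟨S, hS⟩ : (⊤ : Submodule F D).FG := hfin.fg_top
  choose supp hsupp hsupp' using exists_eq_sum_proj 𝒜
  let s : Finset Γ := S.biUnion supp
  have key : ∀ x : D, ∀ γ, GradedRing.proj 𝒜 γ x ≠ 0 →
      ∃ δ ∈ s, ∃ f ∈ F, f ≠ 0 ∧ f ∈ 𝒜 (γ - δ) := by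
    intro x
    have hx : x ∈ Submodule.span F (S : Set D) := hS ▸ Submodule.mem_top
    induction hx using Submodule.span_induction with
    | mem x hx =>
      intro γ hγ
      refine ⟨γ, Finset.mem_biUnion.2 ⟨x, hx, by_contra fun h => hγ (hsupp' x γ h)⟩, 1, F.one_mem,
        hD.1.symm, ?_⟩
      rw [sub_self]
      exact SetLike.one_mem_graded 𝒜
    | zero => intro γ hγ; simp at hγ
    | add x y _ _ hx hy =>
      intro γ hγ
      by_cases h : GradedRing.proj 𝒜 γ x = 0
      · exact hy γ fun h' => hγ (by rw [map_add, h, h', add_zero])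
      · exact hx γ h
    | smul c x _ hx =>
      intro γ hγ
      obtain ⟨α, hα⟩ : ∃ α, GradedRing.proj 𝒜 γ (GradedRing.proj 𝒜 α (c : D) * x) ≠ 0 := by
        by_contra! h
        refine hγ ?_
        change GradedRing.proj 𝒜 γ ((c : D) * x) = 0
        rw [hsupp (c : D), Finset.sum_mul, map_sum]
        exact Finset.sum_eq_zero fun α _ => h α
      rw [proj_mul_left 𝒜 (proj_mem 𝒜 α _)] at hα
      obtain ⟨δ, hδ, f, hf, hf0, hfg⟩ := hx _ (right_ne_zero_of_mul hα)
      refine ⟨δ, hδ, f * GradedRing.proj 𝒜 α (c : D), F.mul_mem hf (hF.1.proj_mem c.2 α),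
        mul_ne_zero hf0 (left_ne_zero_of_mul hα), ?_⟩
      have := mul_mem_grade 𝒜 hfg (proj_mem 𝒜 α (c : D))
      rwa [sub_right_comm, sub_add_cancel] at this
  exact ⟨s, fun γ x hx h0 => key x γ (by rwa [proj_of_mem 𝒜 hx])⟩

theorem finite_center_grade0 (hD : IsGradedDivisionRing 𝒜) (hFcen : F = Subring.center D)
    (hfin : finiteOver F) :
    Module.Finite (Subring.center (grade0 𝒜)) (grade0 𝒜) := by
  have hF : IsGradedDivSubring 𝒜 F := hFcen ▸ isGradedDivSubring_center hD
  obtain ⟨S, hS⟩ : (⊤ : Submodule F D).FG := hfin.fg_top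
  choose supp hsupp hsupp' using exists_eq_sum_proj 𝒜
  have hf : ∀ γ, ∃ f : D, f ∈ F ∧ f ∈ 𝒜 (-γ) ∧ ∀ c ∈ F, c ∈ 𝒜 (-γ) →
      ∃ z ∈ F, z ∈ 𝒜 0 ∧ c = z * f := by
    intro γ
    by_cases h : ∃ f ∈ F, f ∈ 𝒜 (-γ) ∧ f ≠ 0
    · obtain ⟨f, hf, hfγ, hf0⟩ := h
      refine ⟨f, hf, hfγ, fun c hc hcγ => ?_⟩
      obtain ⟨g, hg, hfg, hgf⟩ := hF.2 _ f hf hfγ hf0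
      refine ⟨c * g, F.mul_mem hc hg, ?_, by rw [mul_assoc, hgf, mul_one]⟩
      have := mul_mem_grade 𝒜 hcγ (hD.mem_inv hfγ hfg)
      rwa [add_neg_cancel] at this
    · push Not at h
      exact ⟨0, F.zero_mem, (𝒜 _).zero_mem, fun c hc hcγ =>
        ⟨0, F.zero_mem, (𝒜 _).zero_mem, by rw [h c hc hcγ, zero_mul]⟩⟩
  choose f hfF hfγ hfc using hf
  have hmem0 : ∀ γ x, f γ * GradedRing.proj 𝒜 γ x ∈ grade0 𝒜 := fun γ x => by
    have := mul_mem_grade 𝒜 (hfγ γ) (proj_mem 𝒜 γ x)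
    rwa [neg_add_cancel] at this
  classical
  let b : Finset (grade0 𝒜) :=
    S.biUnion fun x => (supp x).image fun γ => ⟨f γ * GradedRing.proj 𝒜 γ x, hmem0 γ x⟩
  let W := Submodule.span (Subring.center (grade0 𝒜)) (b : Set (grade0 𝒜))
  have key : ∀ x : D, ∀ c ∈ F, (⟨GradedRing.proj 𝒜 0 (c * x), proj_mem 𝒜 0 _⟩ : grade0 𝒜) ∈ W := by
    intro x
    have hx : x ∈ Submodule.span F (S : Set D) := hS ▸ Submodule.mem_top
    induction hx using Submodule.span_induction with
    | mem x hx =>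
      intro c hc
      choose z hzF hz0 hz using fun γ => hfc γ _ (hF.1.proj_mem hc (-γ)) (proj_mem 𝒜 _ c)
      have hzc : ∀ γ, (⟨z γ, hz0 γ⟩ : grade0 𝒜) ∈ Subring.center (grade0 𝒜) := fun γ => by
        rw [Subring.mem_center_iff]
        intro g
        have := hzF γ
        rw [hFcen] at this
        exact Subtype.ext (Subring.mem_center_iff.1 this g)
      have heq : (⟨GradedRing.proj 𝒜 0 (c * x), proj_mem 𝒜 0 _⟩ : grade0 𝒜) =
          ∑ γ ∈ supp x, (⟨_, hzc γ⟩ : Subring.center (grade0 𝒜)) •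
            (⟨f γ * GradedRing.proj 𝒜 γ x, hmem0 γ x⟩ : grade0 𝒜) := by
        apply Subtype.ext
        rw [AddSubmonoidClass.coe_finsetSum]
        change GradedRing.proj 𝒜 0 (c * x) = ∑ γ ∈ supp x, z γ * (f γ * GradedRing.proj 𝒜 γ x)
        conv_lhs => rw [hsupp x]
        rw [Finset.mul_sum, map_sum]
        refine Finset.sum_congr rfl fun γ _ => ?_
        rw [proj_mul_right 𝒜 (proj_mem 𝒜 γ x), zero_sub, hz γ, mul_assoc]
      rw [heq]
      exact W.sum_mem fun γ hγ => W.smul_mem _ (Submodule.subset_span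
        (Finset.mem_coe.2 (Finset.mem_biUnion.2 ⟨x, hx, Finset.mem_image_of_mem _ hγ⟩)))
    | zero =>
      intro c _
      convert W.zero_mem
      apply Subtype.ext
      simp
    | add x y _ _ hx hy =>
      intro c hc
      convert W.add_mem (hx c hc) (hy c hc)
      apply Subtype.ext
      simp [mul_add]
    | smul d x _ hx =>
      intro c hc
      convert hx (c * d) (F.mul_mem hc d.2) using 2
      exact Subtype.ext (congrArg (GradedRing.proj 𝒜 0) (mul_assoc c (d : D) x).symm)
  refine ⟨b, eq_top_iff.2 fun x _ => ?_⟩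
  have := key x 1 F.one_mem
  rw [one_mul] at this
  convert this
  exact Subtype.ext (proj_of_mem 𝒜 x.2).symm

end Finiteness

section SkolemNoether

variable {Δ : Type*} [DivisionRing Δ]

theorem eq_zero_of_sum_mul_mul_eq_zero {ι : Type*} {y : ι → Δ}
    (hy : LinearIndependent (Subring.center Δ) y) (s : Finset ι) (d : ι → Δ)
    (h : ∀ a, ∑ i ∈ s, d i * a * y i = 0) : ∀ i ∈ s, d i = 0 := by
  classical
  induction s using Finset.induction_on generalizing d with
  | empty => simp
  | insert j s hj ih =>
    have hdj : d j = 0 := by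
      by_contra h0
      let e : ι → Δ := fun i => (d j)⁻¹ * d i
      have he : ∀ a, a * y j + ∑ i ∈ s, e i * a * y i = 0 := fun a => by
        have := congrArg ((d j)⁻¹ * ·) (h a)
        simp only [Finset.sum_insert hj, mul_add, Finset.mul_sum, mul_zero, ← mul_assoc,
          inv_mul_cancel₀ h0, one_mul] at this
        exact this
      have hcen : ∀ b, ∀ i ∈ s, b * e i - e i * b = 0 := by
        intro b
        refine ih (fun i => b * e i - e i * b) fun a => ?_
        have h1 := congrArg (b * ·) (he a)
        have h2 := he (b * a)
        simp only [mul_add, Finset.mul_sum, mul_zero, ← mul_assoc] at h1 h2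
        have h3 : ∑ i ∈ s, b * e i * a * y i - ∑ i ∈ s, e i * b * a * y i = 0 := by
          rw [eq_neg_of_add_eq_zero_right h1, eq_neg_of_add_eq_zero_right h2, sub_self]
        rw [← h3, ← Finset.sum_sub_distrib]
        simp only [sub_mul]
      have hmem : ∀ i ∈ s, e i ∈ Subring.center Δ := fun i hi =>
        Subring.mem_center_iff.2 fun b => sub_eq_zero.1 (hcen b i hi)
      let z : ι → Subring.center Δ := fun i =>
        if hi : i ∈ s then ⟨e i, hmem i hi⟩ else if i = j then 1 else 0
      have hz : ∑ i ∈ insert j s, z i • y i = 0 := by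
        rw [Finset.sum_insert hj, ← he 1]
        congr 1
        · simp [z, hj]
        · refine Finset.sum_congr rfl fun i hi => ?_
          simp only [z, dif_pos hi, mul_one]
          rfl
      have := linearIndependent_iff'.1 hy _ z hz j (Finset.mem_insert_self j s)
      simp [z, hj] at this
    intro i hi
    rcases Finset.mem_insert.1 hi with rfl | hi
    · exact hdj
    · refine ih d (fun a => ?_) i hi
      have := h a
      rwa [Finset.sum_insert hj, hdj, zero_mul, zero_mul, zero_add] at this

/-- Skolem--Noether for division rings: an automorphism which is the identity on the center is
inner. -/
theorem exists_mul_eq_of_fix_center [Module.Finite (Subring.center Δ) Δ] (σ : Δ ≃+* Δ)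
    (hσ : ∀ z ∈ Subring.center Δ, σ z = z) : ∃ x ≠ 0, ∀ a, x * a = σ a * x := by
  let b := Module.finBasis (Subring.center Δ) Δ
  let R : Fin (Module.finrank (Subring.center Δ) Δ) → (Δ →ₗ[Subring.center Δ] Δ) :=
    fun i => LinearMap.mulRight _ (b i)
  have hR : LinearIndependent Δ R := by
    rw [linearIndependent_iff']
    intro s d hd
    refine eq_zero_of_sum_mul_mul_eq_zero b.linearIndependent s d fun a => ?_
    have := LinearMap.congr_fun hd a
    simpa [R, LinearMap.sum_apply, mul_assoc] using this
  have hspan := hR.span_eq_top_of_card_eq_finrank'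
    (by rw [Fintype.card_fin, Module.finrank_linearMap_self])
  let σ' : Δ →ₗ[Subring.center Δ] Δ :=
    { toFun := σ
      map_add' := map_add σ
      map_smul' := fun z a => by
        change σ (z * a) = z * σ a
        rw [map_mul, hσ z z.2] }
  have hmem : σ' ∈ Submodule.span Δ (Set.range R) := hspan ▸ Submodule.mem_top
  obtain ⟨x, hx⟩ := (Submodule.mem_span_range_iff_exists_fun Δ).1 hmem
  have hx' : ∀ a, σ a = ∑ i, x i * a * b i := fun a => by
    have := LinearMap.congr_fun hx a
    rw [show σ a = σ' a from rfl, ← this]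
    simp [R, LinearMap.sum_apply, mul_assoc]
  have hcomm : ∀ a i, x i * a = σ a * x i := fun a i => by
    refine sub_eq_zero.1 (eq_zero_of_sum_mul_mul_eq_zero b.linearIndependent Finset.univ
      (fun i => x i * a - σ a * x i) (fun c => ?_) i (Finset.mem_univ i))
    simp only [sub_mul, Finset.sum_sub_distrib]
    rw [sub_eq_zero]
    have := map_mul σ a c
    rw [hx' (a * c), hx' c, Finset.mul_sum] at this
    simpa only [mul_assoc] using this
  obtain ⟨i, hi⟩ : ∃ i, x i ≠ 0 := by
    by_contra! h
    have := hx' 1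
    simp [h] at this
  exact ⟨x i, hi, fun a => hcomm a i⟩

end SkolemNoether

section Descent

/-- Galois descent for a finite group of ring automorphisms of `B` acting on a commutative subring
`T` in such a way that every nontrivial element moves some element of `T` by a unit: `B` is
generated by `T` and the fixed elements. -/
theorem mem_of_finite_group_of_separating {B : Type*} [Ring B] (G : Subgroup (RingAut B)) [Finite G]
    {T R : Subring B} (hT : ∀ x ∈ T, ∀ y ∈ T, x * y = y * x)
    (hGT : ∀ σ ∈ G, ∀ t ∈ T, σ t ∈ T)
    (hsep : ∀ σ ∈ G, σ ≠ 1 → ∃ t ∈ T, ∃ s ∈ T, s * (t - σ t) = 1)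
    (hTR : T ≤ R) (hfix : ∀ b, (∀ σ ∈ G, σ b = b) → b ∈ R) (b : B) : b ∈ R := by
  classical
  have := Fintype.ofFinite G
  let 𝓕 : AddSubgroup (G → B) := AddSubgroup.closure
    {φ | ∃ x ∈ T, ∃ y ∈ T, ∀ σ : G, φ σ = x * (σ : RingAut B) y}
  have hmul : ∀ s ∈ T, ∀ t ∈ T, ∀ c ∈ T, ∀ φ ∈ 𝓕,
      (fun σ : G => φ σ * (s * ((σ : RingAut B) t - c))) ∈ 𝓕 := by
    intro s hs t ht c hc φ hφ
    induction hφ using AddSubgroup.closure_induction with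
    | mem φ h =>
      obtain ⟨x, hx, y, hy, h⟩ := h
      have h1 : (fun σ : G => φ σ * (s * ((σ : RingAut B) t - c))) =
          (fun σ : G => x * s * (σ : RingAut B) (y * t)) -
            (fun σ : G => x * s * c * (σ : RingAut B) y) := by
        funext σ
        have hσ := hGT σ σ.2 y hy
        rw [Pi.sub_apply, h, map_mul, mul_sub, mul_sub]
        congr 1
        · rw [mul_assoc, ← mul_assoc _ s, hT _ hσ s hs]
          simp only [mul_assoc]
        · rw [mul_assoc, hT _ hσ (s * c) (T.mul_mem hs hc)]
          simp only [mul_assoc]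
      rw [h1]
      exact 𝓕.sub_mem
        (AddSubgroup.subset_closure
          ⟨x * s, T.mul_mem hx hs, y * t, T.mul_mem hy ht, fun σ => rfl⟩)
        (AddSubgroup.subset_closure
          ⟨x * s * c, T.mul_mem (T.mul_mem hx hs) hc, y, hy, fun σ => rfl⟩)
    | zero =>
      convert 𝓕.zero_mem using 1
      funext σ
      simp
    | add φ ψ _ _ h h' =>
      convert 𝓕.add_mem h h' using 1
      funext σ
      simp [add_mul]
    | neg φ _ h =>
      convert 𝓕.neg_mem h using 1
      funext σ
      simp
  have hdelta : ∀ u : Finset G, 1 ∉ u → ∃ φ ∈ 𝓕, φ 1 = 1 ∧ ∀ σ ∈ u, φ σ = 0 := by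
    intro u
    induction u using Finset.induction_on with
    | empty =>
      exact fun _ => ⟨fun _ => 1, AddSubgroup.subset_closure
        ⟨1, T.one_mem, 1, T.one_mem, fun σ => by simp⟩, rfl, by simp⟩
    | insert τ u hτ ih =>
      intro h1
      rw [Finset.mem_insert, not_or] at h1
      obtain ⟨φ, hφ, hφ1, hφu⟩ := ih h1.2
      obtain ⟨t, ht, s, hs, hst⟩ := hsep τ τ.2 fun h => h1.1 (Subtype.ext h.symm)
      refine ⟨_, hmul s hs t ht _ (hGT τ τ.2 t ht) φ hφ, ?_, fun σ hσ => ?_⟩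
      · rw [hφ1, one_mul]
        exact hst
      · rcases Finset.mem_insert.1 hσ with rfl | hσ
        · simp
        · simp [hφu σ hσ]
  have htrace : ∀ φ ∈ 𝓕, ∑ σ : G, φ σ * (σ : RingAut B) b ∈ R := by
    intro φ hφ
    induction hφ using AddSubgroup.closure_induction with
    | mem φ h =>
      obtain ⟨x, hx, y, hy, h⟩ := h
      have h1 : ∑ σ : G, φ σ * (σ : RingAut B) b = x * ∑ σ : G, (σ : RingAut B) (y * b) := by
        rw [Finset.mul_sum]
        exact Finset.sum_congr rfl fun σ _ => by rw [h, map_mul, mul_assoc]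
      rw [h1]
      refine R.mul_mem (hTR hx) (hfix _ fun τ hτ => ?_)
      rw [map_sum]
      exact Fintype.sum_equiv (Equiv.mulLeft (⟨τ, hτ⟩ : G)) _ _ fun σ => rfl
    | zero => simp
    | add φ ψ _ _ h h' =>
      simp only [Pi.add_apply, add_mul, Finset.sum_add_distrib]
      exact R.add_mem h h'
    | neg φ _ h =>
      simp only [Pi.neg_apply, neg_mul, Finset.sum_neg_distrib]
      exact R.neg_mem h
  obtain ⟨φ, hφ, hφ1, hφ0⟩ := hdelta (Finset.univ.erase 1) (Finset.notMem_erase _ _)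
  have := htrace φ hφ
  rw [Finset.sum_eq_single (1 : G)
    (fun σ _ hσ => by rw [hφ0 σ (Finset.mem_erase.2 ⟨hσ, Finset.mem_univ σ⟩), zero_mul])
    (fun h => absurd (Finset.mem_univ _) h), hφ1, one_mul] at this
  exact this

end Descent

section Conjugation

variable {Γ : Type*} [AddCommGroup Γ] [DecidableEq Γ] {D : Type*} [Ring D]

/-- Conjugation by `x` (with inverse `y`), as an automorphism of a subring it preserves. -/
def conjAut (S : Subring D) (x y : D) (hxy : x * y = 1) (hyx : y * x = 1)
    (h : ∀ b ∈ S, x * b * y ∈ S) (h' : ∀ b ∈ S, y * b * x ∈ S) : RingAut S where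
  toFun b := ⟨x * b * y, h b b.2⟩
  invFun b := ⟨y * b * x, h' b b.2⟩
  left_inv b := Subtype.ext <| by
    change y * (x * b * y) * x = b
    rw [show y * (x * b * y) * x = (y * x) * b * (y * x) by simp only [mul_assoc], hyx, one_mul,
      mul_one]
  right_inv b := Subtype.ext <| by
    change x * (y * b * x) * y = b
    rw [show x * (y * b * x) * y = (x * y) * b * (x * y) by simp only [mul_assoc], hxy, one_mul,
      mul_one]
  map_mul' a b := Subtype.ext <| by
    change x * (a * b) * y = x * a * y * (x * b * y)
    rw [show x * (a : D) * y * (x * b * y) = x * a * (y * x) * b * y by simp only [mul_assoc], hyx,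
      mul_one]
    simp only [mul_assoc]
  map_add' a b := Subtype.ext <| by
    change x * (a + b) * y = x * a * y + x * b * y
    rw [mul_add, add_mul]

variable (𝒜 : Γ → AddSubgroup D) [GradedRing 𝒜]

/-- The group of automorphisms of `S` induced by conjugation by homogeneous units of `E`. -/
def conjGroup (E S : Subring D) : Subgroup (RingAut S) where
  carrier := {σ | ∃ γ x y, x ∈ E ∧ y ∈ E ∧ x ∈ 𝒜 γ ∧ y ∈ 𝒜 (-γ) ∧ x * y = 1 ∧ y * x = 1 ∧
    ∀ b : S, (σ b : D) = x * b * y}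
  one_mem' := ⟨0, 1, 1, E.one_mem, E.one_mem, SetLike.one_mem_graded 𝒜,
    by rw [neg_zero]; exact SetLike.one_mem_graded 𝒜, mul_one 1, mul_one 1, fun b => by simp⟩
  mul_mem' := by
    rintro σ τ ⟨γ, x, y, hx, hy, hxγ, hyγ, hxy, hyx, h⟩ ⟨δ, x', y', hx', hy', hxδ, hyδ, hxy', hyx', h'⟩
    refine ⟨γ + δ, x * x', y' * y, E.mul_mem hx hx', E.mul_mem hy' hy, mul_mem_grade 𝒜 hxγ hxδ,
      ?_, ?_, ?_, fun b => ?_⟩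
    · rw [neg_add_rev]
      exact mul_mem_grade 𝒜 hyδ hyγ
    · rw [show x * x' * (y' * y) = x * (x' * y') * y by simp only [mul_assoc], hxy', mul_one, hxy]
    · rw [show y' * y * (x * x') = y' * (y * x) * x' by simp only [mul_assoc], hyx, mul_one, hyx']
    · rw [RingAut.mul_apply, h, h']
      simp only [mul_assoc]
  inv_mem' := by
    rintro σ ⟨γ, x, y, hx, hy, hxγ, hyγ, hxy, hyx, h⟩
    refine ⟨-γ, y, x, hy, hx, hyγ, by rwa [neg_neg], hyx, hxy, fun b => ?_⟩
    have := h (σ⁻¹ b)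
    rw [show σ (σ⁻¹ b) = b from σ.apply_symm_apply b] at this
    rw [this, show y * (x * (σ⁻¹ b : S) * y) * x = (y * x) * (σ⁻¹ b : S) * (y * x) by
      simp only [mul_assoc], hyx, one_mul, mul_one]

variable {𝒜}

theorem finite_conjGroup (hΓ : TorsionFree Γ) (hD : IsGradedDivisionRing 𝒜) {F E S : Subring D}
    (hF : IsGradedDivSubring 𝒜 F) (hFcen : F ≤ Subring.center D) (hfin : finiteOver F)
    (hFE : F ≤ E) (hES : ∀ x ∈ E, x ∈ 𝒜 0 → x ∈ Subring.centralizer (S : Set D)) :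
    Finite (conjGroup 𝒜 E S) := by
  obtain ⟨s, hs⟩ := exists_finite_degrees hΓ hD hF hfin
  have key : ∀ σ : conjGroup 𝒜 E S, ∃ δ : s, ∃ z w, z ∈ E ∧ w ∈ E ∧ z ∈ 𝒜 δ ∧ w ∈ 𝒜 (-δ) ∧
      z * w = 1 ∧ w * z = 1 ∧ ∀ b : S, ((σ : RingAut S) b : D) = z * b * w := by
    rintro ⟨σ, γ, x, y, hx, hy, hxγ, hyγ, hxy, hyx, h⟩
    obtain ⟨δ, hδ, f, hf, hf0, hfγ⟩ := hs γ x hxγ (ne_zero_of_mul_eq_one hD hxy)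
    obtain ⟨g, hg, hfg, hgf⟩ := hF.2 _ f hf hfγ hf0
    have hgγ := hD.mem_inv hfγ hfg
    have hzw : g * x * (y * f) = 1 := by
      rw [show g * x * (y * f) = g * (x * y) * f by simp only [mul_assoc], hxy, mul_one, hgf]
    have hz : g * x ∈ 𝒜 δ := by
      have := mul_mem_grade 𝒜 hgγ hxγ
      rwa [neg_sub, sub_add_cancel] at this
    refine ⟨⟨δ, hδ⟩, g * x, y * f, E.mul_mem (hFE hg) hx, E.mul_mem hy (hFE hf), hz,
      hD.mem_inv hz hzw, hzw, ?_, fun b => ?_⟩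
    · rw [show y * f * (g * x) = y * (f * g) * x by simp only [mul_assoc], hfg, mul_one, hyx]
    · change (σ b : D) = _
      have hgc := Subring.mem_center_iff.1 (hFcen hg)
      rw [h, show g * x * b * (y * f) = g * (x * b * y) * f by simp only [mul_assoc], ← hgc,
        mul_assoc _ g f, hgf, mul_one]
  choose δ z w hz hw hzδ hwδ hzw hwz h using key
  refine Finite.of_injective δ fun σ τ hστ => ?_
  apply Subtype.ext
  ext b
  rw [h σ b, h τ b]
  have h0 : w τ * z σ ∈ 𝒜 0 := by
    have := mul_mem_grade 𝒜 (hwδ τ) (hzδ σ)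
    rwa [hστ, neg_add_cancel] at this
  have hc := Subring.mem_centralizer_iff.1 (hES _ (E.mul_mem (hw τ) (hz σ)) h0) b b.2
  calc z σ * b * w σ = z τ * (w τ * z σ * b) * w σ := by
        rw [show z τ * (w τ * z σ * b) * w σ = (z τ * w τ) * z σ * b * w σ by
          simp only [mul_assoc], hzw, one_mul]
    _ = z τ * b * w τ := by
        rw [← hc, show z τ * (b * (w τ * z σ)) * w σ = z τ * b * w τ * (z σ * w σ) by
          simp only [mul_assoc], hzw, mul_one]

end Conjugation

section Descended

variable {Γ : Type*} [AddCommGroup Γ] [DecidableEq Γ] {D : Type*} [Ring D]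
  {𝒜 : Γ → AddSubgroup D} [GradedRing 𝒜] {F M T : Subring D}

theorem mem_Cc_iff (hFcen : F = Subring.center D) {x : D} :
    x ∈ Cc 𝒜 F ↔ ∀ d ∈ 𝒜 0, d * x = x * d := by
  rw [Cc, Subring.mem_centralizer_iff]
  refine ⟨fun h d hd => h d ((le_sup_left : grade0 𝒜 ≤ grade0 𝒜 ⊔ F) hd), fun h => ?_⟩
  have : Uc 𝒜 F ≤ Subring.centralizer {x} := by
    refine sup_le (fun y hy => ?_) (fun y hy => ?_)
    · rw [Subring.mem_centralizer_iff]
      rintro _ rfl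
      exact (h y hy).symm
    · rw [hFcen] at hy
      exact Subring.center_le_centralizer _ hy
  exact fun y hy => (Subring.mem_centralizer_iff.1 (this hy) x rfl).symm

theorem mem_centralizer_sup {A B : Subring D} {x : D} :
    x ∈ Subring.centralizer ((A ⊔ B : Subring D) : Set D) ↔
      x ∈ Subring.centralizer (A : Set D) ∧ x ∈ Subring.centralizer (B : Set D) := by
  refine ⟨fun h => ⟨Subring.centralizer_le _ _ (SetLike.coe_subset_coe.2 le_sup_left) h,
    Subring.centralizer_le _ _ (SetLike.coe_subset_coe.2 le_sup_right) h⟩, fun h => ?_⟩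
  have : A ⊔ B ≤ Subring.centralizer {x} := sup_le
    (fun y hy => Subring.mem_centralizer_iff.2 <| by
      rintro _ rfl; exact (Subring.mem_centralizer_iff.1 h.1 y hy).symm)
    (fun y hy => Subring.mem_centralizer_iff.2 <| by
      rintro _ rfl; exact (Subring.mem_centralizer_iff.1 h.2 y hy).symm)
  exact Subring.mem_centralizer_iff.2 fun y hy =>
    (Subring.mem_centralizer_iff.1 (this hy) x rfl).symm

/-- The compositum `(M ∩ C_D(T)) ⬝ T`. -/
abbrev descended (M T : Subring D) : Subring D := (M ⊓ Subring.centralizer (T : Set D)) ⊔ T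

theorem mem_centralizer_of_grade_zero (hFcen : F = Subring.center D)
    (hT : IsMaxGradedSubfieldOf 𝒜 (Cc 𝒜 F) T) {x : D}
    (hx : x ∈ 𝒜 0) : x ∈ Subring.centralizer (T : Set D) :=
  Subring.mem_centralizer_iff.2 fun _ ht => ((mem_Cc_iff hFcen).1 (hT.2.1 ht) x hx).symm

variable (hD : IsGradedDivisionRing 𝒜) (hFcen : F = Subring.center D)
include hD hFcen

theorem le_of_isMaxGradedSubfieldOf_Cc (hT : IsMaxGradedSubfieldOf 𝒜 (Cc 𝒜 F) T) : F ≤ T :=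
  fun x hx => by
    have hx' := Subring.mem_center_iff.1 (hFcen ▸ hx : x ∈ Subring.center D)
    exact hT.mem_of_commute hD (isGradedDivSubring_Cc 𝒜 hD hFcen)
      ((mem_Cc_iff hFcen).2 fun d _ => hx' d) (Subring.mem_centralizer_iff.2 fun t _ => hx' t)

theorem le_of_isMaxGradedSubfieldOf_top (hM : IsMaxGradedSubfieldOf 𝒜 ⊤ M) : F ≤ M :=
  fun x hx => by
    have hx' := Subring.mem_center_iff.1 (hFcen ▸ hx : x ∈ Subring.center D)
    exact hM.mem_of_commute hD (isGradedDivSubring_top hD) trivial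
      (Subring.mem_centralizer_iff.2 fun t _ => hx' t)

/-- The center of `D₀` is contained in every maximal graded subfield of `C`. -/
theorem mem_of_commute_grade0 (hT : IsMaxGradedSubfieldOf 𝒜 (Cc 𝒜 F) T) {x : D} (hx : x ∈ 𝒜 0)
    (h : ∀ d ∈ 𝒜 0, d * x = x * d) : x ∈ T :=
  hT.mem_of_commute hD (isGradedDivSubring_Cc 𝒜 hD hFcen) ((mem_Cc_iff hFcen).2 h)
    (Subring.mem_centralizer_iff.2 fun _ ht =>
      ((mem_Cc_iff hFcen).1 (hT.2.1 ht) x hx).symm)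

/-- Maximal graded subfields of `C` are normalized by the homogeneous units of `D`. -/
theorem conj_mem_of_isMaxGradedSubfieldOf_Cc (hT : IsMaxGradedSubfieldOf 𝒜 (Cc 𝒜 F) T) {γ : Γ}
    {m n : D} (hm : m ∈ 𝒜 γ) (hmn : m * n = 1) {t : D} (ht : t ∈ T) :
    m * t * n ∈ T := by
  have hn := hD.mem_inv hm hmn
  have homog : ∀ δ, ∀ t ∈ T, t ∈ 𝒜 δ → m * t * n ∈ T := by
    intro δ t ht htδ
    by_cases h0 : t = 0
    · rw [h0, mul_zero, zero_mul]
      exact T.zero_mem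
    obtain ⟨u, hu, htu, hut⟩ := hT.1.1.2 δ t ht htδ h0
    have hC := (mem_Cc_iff (𝒜 := 𝒜) hFcen).1 (hT.2.1 ht)
    have hC' := (mem_Cc_iff (𝒜 := 𝒜) hFcen).1 (hT.2.1 hu)
    have hw : m * t * n * u ∈ T := by
      refine mem_of_commute_grade0 hD hFcen hT ?_ fun d hd => ?_
      · have := mul_mem_grade 𝒜 (mul_mem_grade 𝒜 (mul_mem_grade 𝒜 hm htδ) hn)
          (hD.mem_inv htδ htu)
        rwa [show γ + δ + -γ + -δ = 0 by abel] at this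
      · have hd' : n * d * m ∈ 𝒜 0 := by
          have := mul_mem_grade 𝒜 (mul_mem_grade 𝒜 hn hd) hm
          rwa [show -γ + 0 + γ = 0 by abel] at this
        calc d * (m * t * n * u) = m * n * d * m * t * n * u := by
              rw [hmn, one_mul]; simp only [mul_assoc]
          _ = m * (n * d * m * t) * n * u := by simp only [mul_assoc]
          _ = m * t * n * d * (m * n) * u := by rw [hC _ hd']; simp only [mul_assoc]
          _ = m * t * n * u * d := by
            rw [hmn, mul_one, mul_assoc _ d u, hC' d hd]; simp only [mul_assoc]
    have := T.mul_mem hw ht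
    rwa [mul_assoc _ u t, hut, mul_one] at this
  obtain ⟨s, hs, -⟩ := exists_eq_sum_proj 𝒜 t
  rw [hs, Finset.mul_sum, Finset.sum_mul]
  exact T.sum_mem fun δ _ => homog δ _ (hT.1.1.1.proj_mem ht δ) (proj_mem 𝒜 δ t)

theorem centralizer_descended (hΓ : TorsionFree Γ) (hfin : finiteOver F)
    (hM : IsMaxGradedSubfieldOf 𝒜 ⊤ M) (hT : IsMaxGradedSubfieldOf 𝒜 (Cc 𝒜 F) T) :
    Subring.centralizer (descended M T : Set D) = descended M T := by
  have hF : IsGradedDivSubring 𝒜 F := hFcen ▸ isGradedDivSubring_center hD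
  set B := Subring.centralizer (descended M T : Set D) with hB
  have hTB : T ≤ B := fun t ht => mem_centralizer_sup.2
    ⟨Subring.mem_centralizer_iff.2 fun n hn => (Subring.mem_centralizer_iff.1 hn.2 t ht).symm,
      Subring.mem_centralizer_iff.2 fun s hs => hT.1.2 s hs t ht⟩
  have hNB : M ⊓ Subring.centralizer (T : Set D) ≤ B := fun x hx => mem_centralizer_sup.2
    ⟨Subring.mem_centralizer_iff.2 fun n hn => hM.1.2 n hn.1 x hx.1, hx.2⟩
  refine le_antisymm (fun b hb => ?_) (sup_le hNB hTB)
  have hM0 : ∀ x ∈ M, x ∈ 𝒜 0 → x ∈ Subring.centralizer (B : Set D) := fun x hx hx0 =>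
    Subring.mem_centralizer_iff.2 fun b hb => by
      have hxN : x ∈ M ⊓ Subring.centralizer (T : Set D) :=
        ⟨hx, mem_centralizer_of_grade_zero hFcen hT hx0⟩
      exact (Subring.mem_centralizer_iff.1 (mem_centralizer_sup.1 hb).1 x hxN).symm
  have := finite_conjGroup hΓ hD hF hFcen.le hfin (le_of_isMaxGradedSubfieldOf_top hD hFcen hM) hM0
  have hnorm : ∀ γ, ∀ m ∈ M, m ∈ 𝒜 γ → ∀ n ∈ M, m * n = 1 → n * m = 1 → ∀ b ∈ B,
      m * b * n ∈ B := by
    intro γ m hm hmγ n hn hmn hnm b hb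
    obtain ⟨hbN, hbT⟩ := mem_centralizer_sup.1 hb
    rw [Subring.mem_centralizer_iff] at hbN hbT
    refine mem_centralizer_sup.2
      ⟨Subring.mem_centralizer_iff.2 fun x hx => ?_, Subring.mem_centralizer_iff.2 fun t ht => ?_⟩
    · calc x * (m * b * n) = x * m * b * n := by simp only [mul_assoc]
        _ = m * (x * b) * n := by rw [hM.1.2 x hx.1 m hm]; simp only [mul_assoc]
        _ = m * b * (x * n) := by rw [hbN x hx]; simp only [mul_assoc]
        _ = m * b * n * x := by rw [hM.1.2 x hx.1 n hn]; simp only [mul_assoc]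
    · have ht' : n * t * m ∈ T := conj_mem_of_isMaxGradedSubfieldOf_Cc hD hFcen hT
        (hD.mem_inv hmγ hmn) hnm ht
      calc t * (m * b * n) = m * n * t * m * b * n := by
            rw [hmn, one_mul]; simp only [mul_assoc]
        _ = m * (n * t * m * b) * n := by simp only [mul_assoc]
        _ = m * b * n * t * (m * n) := by rw [hbT _ ht']; simp only [mul_assoc]
        _ = m * b * n * t := by rw [hmn, mul_one]
  have := mem_of_finite_group_of_separating (conjGroup 𝒜 M B) (T := T.comap B.subtype)
    (R := (descended M T).comap B.subtype)
    (fun x hx y hy => Subtype.ext (hT.1.2 x hx y hy))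
    (fun σ hσ t ht => by
      obtain ⟨γ, m, n, -, -, hmγ, -, hmn, hnm, h⟩ := hσ
      change ((σ t : B) : D) ∈ T
      rw [h]
      exact conj_mem_of_isMaxGradedSubfieldOf_Cc hD hFcen hT hmγ hmn ht)
    (fun σ hσ hσ1 => by
      obtain ⟨γ, m, n, hm, hn, hmγ, hnγ, hmn, hnm, h⟩ := hσ
      obtain ⟨δ, t, ht, htδ, hne⟩ : ∃ δ, ∃ t ∈ T, t ∈ 𝒜 δ ∧ t * m ≠ m * t := by
        by_contra! hcon
        have hmN : m ∈ M ⊓ Subring.centralizer (T : Set D) :=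
          ⟨hm, mem_centralizer_of_commute_homogeneous hT.1.1.1 hcon⟩
        apply hσ1
        ext b
        rw [h, Subring.mem_centralizer_iff.1 (mem_centralizer_sup.1 b.2).1 m hmN, mul_assoc, hmn,
          mul_one]
        rfl
      have hct : m * t * n ∈ T :=
        conj_mem_of_isMaxGradedSubfieldOf_Cc hD hFcen hT hmγ hmn ht
      have hctδ : m * t * n ∈ 𝒜 δ := by
        have := mul_mem_grade 𝒜 (mul_mem_grade 𝒜 hmγ htδ) hnγ
        rwa [show γ + δ + -γ = δ by abel] at this
      obtain ⟨s, hs, -, hst⟩ := hT.1.1.2 δ (t - m * t * n) (T.sub_mem ht hct)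
        ((𝒜 δ).sub_mem htδ hctδ) (fun h0 => hne (by
          rw [sub_eq_zero] at h0
          conv_lhs => rw [h0]
          rw [mul_assoc, hnm, mul_one]))
      refine ⟨⟨t, hTB ht⟩, ht, ⟨s, hTB hs⟩, hs, Subtype.ext ?_⟩
      change s * (t - (σ ⟨t, hTB ht⟩ : B)) = 1
      rw [h]
      exact hst)
    (fun t ht => (le_sup_right : T ≤ descended M T) ht)
    (fun b hb => by
      refine (le_sup_left : _ ≤ descended M T) ⟨?_, (mem_centralizer_sup.1 b.2).2⟩
      refine hM.mem_of_commute hD (isGradedDivSubring_top hD) trivial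
        (mem_centralizer_of_commute_homogeneous hM.1.1.1 fun γ m hm hmγ => ?_)
      by_cases h0 : m = 0
      · rw [h0]
        simp
      obtain ⟨n, hn, hmn, hnm⟩ := hM.1.1.2 γ m hm hmγ h0
      have hnγ := hD.mem_inv hmγ hmn
      have := hb (conjAut B m n hmn hnm (hnorm γ m hm hmγ n hn hmn hnm)
        (hnorm _ n hn hnγ m hm hnm hmn))
        ⟨γ, m, n, hm, hn, hmγ, hnγ, hmn, hnm, fun b => rfl⟩
      have h1 : m * b * n = b := congrArg Subtype.val this
      change m * (b : D) = b * m
      conv_rhs => rw [← h1]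
      rw [mul_assoc _ n m, hnm, mul_one])
    ⟨b, hb⟩
  exact this

theorem isMaxGradedSubfieldOf_descended (hΓ : TorsionFree Γ) (hfin : finiteOver F)
    (hM : IsMaxGradedSubfieldOf 𝒜 ⊤ M) (hT : IsMaxGradedSubfieldOf 𝒜 (Cc 𝒜 F) T) :
    IsMaxGradedSubfieldOf 𝒜 ⊤ (descended M T) := by
  have hcent := centralizer_descended hD hFcen hΓ hfin hM hT
  have hgr : IsGradedDivSubring 𝒜 (descended M T) := by
    have h := (isGradedDivSubring_centralizer hD
      (hM.1.1.inf (isGradedDivSubring_centralizer hD hT.1.1.1)).1).inf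
      (isGradedDivSubring_centralizer hD hT.1.1.1)
    rw [← hcent]
    convert h using 1
    ext x
    exact mem_centralizer_sup
  refine ⟨⟨hgr, fun x hx y hy => ?_⟩, le_top, fun K hK _ hle => le_antisymm (fun x hx => ?_) hle⟩
  · rw [← hcent] at hy
    exact Subring.mem_centralizer_iff.1 hy x hx
  · rw [← hcent]
    exact Subring.mem_centralizer_iff.2 fun y hy => hK.2 y (hle hy) x hx

theorem isMaxSubfieldOf_descended (hΓ : TorsionFree Γ) (hfin : finiteOver F)
    (hM : IsMaxGradedSubfieldOf 𝒜 ⊤ M) (hT : IsMaxGradedSubfieldOf 𝒜 (Cc 𝒜 F) T) :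
    IsMaxSubfieldOf (grade0 𝒜) (descended M T ⊓ grade0 𝒜) := by
  have hmax := isMaxGradedSubfieldOf_descended hD hFcen hΓ hfin hM hT
  have hcent := centralizer_descended hD hFcen hΓ hfin hM hT
  refine ⟨⟨inf_le_right, fun x hx y hy => hmax.1.2 x hx.1 y hy.1, fun x hx h0 => ?_⟩,
    fun K hK hle => le_antisymm (fun d hd => ⟨?_, hK.1 hd⟩) hle⟩
  · obtain ⟨y, hy, hxy, hyx⟩ := hmax.1.1.2 0 x hx.1 hx.2 h0
    refine ⟨y, ⟨hy, ?_⟩, hxy, hyx⟩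
    have := hD.mem_inv hx.2 hxy
    rwa [neg_zero] at this
  rw [← hcent]
  refine mem_centralizer_sup.2 ⟨?_, mem_centralizer_of_grade_zero hFcen hT (hK.1 hd)⟩
  have hN : IsGradedDivSubring 𝒜 (M ⊓ Subring.centralizer (T : Set D)) :=
    hM.1.1.inf (isGradedDivSubring_centralizer hD hT.1.1.1)
  refine mem_centralizer_of_commute_homogeneous hN.1 fun γ n hn hnγ => ?_
  by_cases h0 : n = 0
  · rw [h0]
    simp
  obtain ⟨n', hn', hnn', hn'n⟩ := hN.2 γ n hn hnγ h0
  have hn'γ := hD.mem_inv hnγ hnn'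
  have := finite_center_grade0 hD hFcen hfin
  have : Nontrivial (grade0 𝒜) := ⟨0, 1, fun h => hD.1 (congrArg Subtype.val h)⟩
  let _ : DivisionRing (grade0 𝒜) := DivisionRing.ofIsUnitOrEqZero fun a => by
    by_cases ha : a = 0
    · exact Or.inr ha
    · obtain ⟨b, hb, hab, hba⟩ := hD.exists_inv a.2 fun h => ha (Subtype.ext h)
      rw [neg_zero] at hb
      exact Or.inl ⟨⟨a, ⟨b, hb⟩, Subtype.ext hab, Subtype.ext hba⟩, rfl⟩
  have hpres : ∀ x y : D, ∀ δ, x ∈ 𝒜 δ → y ∈ 𝒜 (-δ) → ∀ b ∈ grade0 𝒜, x * b * y ∈ grade0 𝒜 :=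
    fun x y δ hx hy b hb => by
      have := mul_mem_grade 𝒜 (mul_mem_grade 𝒜 hx hb) hy
      rwa [add_zero, add_neg_cancel] at this
  obtain ⟨e, he0, he⟩ := exists_mul_eq_of_fix_center
    (conjAut (grade0 𝒜) n n' hnn' hn'n (hpres n n' γ hnγ hn'γ)
      (hpres n' n (-γ) hn'γ (by rwa [neg_neg]))) fun z hz => by
    have hzT : (z : D) ∈ T := mem_of_commute_grade0 hD hFcen hT z.2 fun d hd =>
      congrArg Subtype.val (Subring.mem_center_iff.1 hz ⟨d, hd⟩)
    apply Subtype.ext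
    change n * z * n' = z
    rw [← Subring.mem_centralizer_iff.1 hn.2 z hzT, mul_assoc, hnn', mul_one]
  obtain ⟨e', he'0, hee', he'e⟩ := hD.exists_inv e.2 fun h => he0 (Subtype.ext h)
  rw [neg_zero] at he'0
  have he1 : ∀ a ∈ 𝒜 0, e * a = n * a * n' * e := fun a ha => congrArg Subtype.val (he ⟨a, ha⟩)
  have ht : e' * n ∈ T := by
    refine hT.mem_of_commute hD (isGradedDivSubring_Cc 𝒜 hD hFcen)
      ((mem_Cc_iff hFcen).2 fun a ha => ?_) (Subring.mul_mem _
        (mem_centralizer_of_grade_zero hFcen hT he'0) hn.2)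
    calc a * (e' * n) = e' * (e * a) * e' * n := by
          rw [show e' * (e * a) * e' * n = (e' * e) * a * e' * n by simp only [mul_assoc], he'e,
            one_mul, mul_assoc]
      _ = e' * n * a * n' * (e * e') * n := by rw [he1 a ha]; simp only [mul_assoc]
      _ = e' * n * a := by rw [hee', mul_one, mul_assoc _ n' n, hn'n, mul_one]
  have htγ : e' * n ∈ 𝒜 γ := by
    have := mul_mem_grade 𝒜 he'0 hnγ
    rwa [zero_add] at this
  have hinv : e' * n * (n' * e) = 1 := by
    rw [show e' * n * (n' * e) = e' * (n * n') * e by simp only [mul_assoc], hnn', mul_one, he'e]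
  have ht' : n' * e ∈ T := hT.1.1.inv_mem hD ht htγ hinv
  have heK : (e : D) ∈ K := by
    refine hle ⟨?_, e.2⟩
    have := (descended M T).mul_mem ((le_sup_left : _ ≤ descended M T) hn)
      ((le_sup_right : _ ≤ descended M T) ht')
    rwa [← mul_assoc, hnn', one_mul] at this
  have hde : (e : D) * d = d * e := hK.2.1 e heK d hd
  have hdt : d * (e' * n) = e' * n * d := (mem_Cc_iff hFcen).1 (hT.2.1 ht) d (hK.1 hd)
  calc n * d = e * (e' * n * d) := by
        rw [show (e : D) * (e' * n * d) = (e * e') * n * d by simp only [mul_assoc], hee', one_mul]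
    _ = e * d * e' * n := by rw [← hdt]; simp only [mul_assoc]
    _ = d * n := by rw [hde, mul_assoc d _ e', hee', mul_one]

end Descended

section SplittingDomain

open Polynomial

variable {A R K L : Type*} [CommRing A] [CommRing R] [Field K] [Field L] [Algebra A R]
  [Algebra A K] [Algebra R L] [Algebra K L] [Algebra A L] [IsScalarTower A K L]
  [IsScalarTower A R L] {S : Set R}

theorem map_map_eq_prod {p : A[X]} {l : Multiset R}
    (h : p.map (algebraMap A R) = (l.map fun r => X - C r).prod) :
    (p.map (algebraMap A K)).map (algebraMap K L) =
      (l.map fun r => X - C (algebraMap R L r)).prod := by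
  rw [map_map, ← IsScalarTower.algebraMap_eq, IsScalarTower.algebraMap_eq A R L, ← map_map, h,
    ← coe_mapRingHom, map_multiset_prod, Multiset.map_map]
  simp

theorem aeval_map_eq_zero {p : A[X]} {l : Multiset R} {s : R}
    (h : p.map (algebraMap A R) = (l.map fun r => X - C r).prod) (hs : s ∈ l) :
    aeval (algebraMap R L s) (p.map (algebraMap A K)) = 0 := by
  rw [aeval_def, ← eval_map, map_map_eq_prod h, eval_multiset_prod]
  refine Multiset.prod_eq_zero (Multiset.mem_map.2 ⟨X - C (algebraMap R L s),
    Multiset.mem_map.2 ⟨s, hs, rfl⟩, by simp⟩)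

variable (L) in
include L in
theorem monic_map_of_eq_prod {p : A[X]} {l : Multiset R}
    (h : p.map (algebraMap A R) = (l.map fun r => X - C r).prod) :
    (p.map (algebraMap A K)).Monic := by
  refine monic_of_injective (algebraMap K L).injective ?_
  rw [map_map_eq_prod h]
  exact monic_multiset_prod_of_monic _ _ fun r _ => monic_X_sub_C _

theorem isIntegral_and_splits_of_eq_prod {p : A[X]} {l : Multiset R} {s : R}
    (h : p.map (algebraMap A R) = (l.map fun r => X - C r).prod) (hs : s ∈ l) :
    IsIntegral K (algebraMap R L s) ∧
      ((minpoly K (algebraMap R L s)).map (algebraMap K L)).Splits := by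
  refine ⟨⟨_, monic_map_of_eq_prod L h, aeval_map_eq_zero h hs⟩, ?_⟩
  have hdvd := Polynomial.map_dvd (algebraMap K L)
    (minpoly.dvd K (algebraMap R L s) (aeval_map_eq_zero h hs))
  refine Splits.of_dvd ?_ ((monic_map_of_eq_prod L h).map _).ne_zero hdvd
  rw [map_map_eq_prod h]
  exact Splits.multisetProd fun f hf => by
    obtain ⟨r, -, rfl⟩ := Multiset.mem_map.1 hf
    exact Splits.X_sub_C _

/-- An automorphism of the fraction field preserves the ring generated by a set of elements which
is closed under conjugation. -/
theorem exists_algebraMap_eq_apply (hS : Algebra.adjoin A S = ⊤)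
    (hsplit : ∀ s ∈ S, ∃ (p : A[X]) (l : Multiset R),
      p.map (algebraMap A R) = (l.map fun r => X - C r).prod ∧ s ∈ l ∧ ∀ r ∈ l, r ∈ S)
    (σ : L ≃ₐ[K] L) (r : R) : ∃ r', algebraMap R L r' = σ (algebraMap R L r) := by
  have hr : r ∈ Algebra.adjoin A S := hS ▸ Algebra.mem_top
  induction hr using Algebra.adjoin_induction with
  | mem s hs =>
    obtain ⟨p, l, h, hsl, -⟩ := hsplit s hs
    have h0 : aeval (σ (algebraMap R L s)) (p.map (algebraMap A K)) = 0 := by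
      have := congrArg σ (aeval_map_eq_zero (K := K) (L := L) h hsl)
      rwa [map_zero, ← aeval_algHom_apply] at this
    rw [aeval_def, ← eval_map, map_map_eq_prod h, eval_multiset_prod, Multiset.prod_eq_zero_iff]
      at h0
    simp only [Multiset.map_map, Multiset.mem_map, Function.comp_apply, eval_sub, eval_X, eval_C]
      at h0
    obtain ⟨r, -, hr⟩ := h0
    exact ⟨r, (sub_eq_zero.1 hr).symm⟩
  | algebraMap a =>
    refine ⟨algebraMap A R a, ?_⟩
    rw [← IsScalarTower.algebraMap_apply, IsScalarTower.algebraMap_apply A K L, σ.commutes]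
  | add x y _ _ hx hy =>
    obtain ⟨⟨x', hx⟩, ⟨y', hy⟩⟩ := hx, hy
    exact ⟨x' + y', by simp [hx, hy]⟩
  | mul x y _ _ hx hy =>
    obtain ⟨⟨x', hx⟩, ⟨y', hy⟩⟩ := hx, hy
    exact ⟨x' * y', by simp [hx, hy]⟩

variable [IsFractionRing R L]

variable (K L) in
theorem adjoin_image_eq_top (hS : Algebra.adjoin A S = ⊤) :
    IntermediateField.adjoin K (algebraMap R L '' S) = ⊤ := by
  rw [eq_top_iff]
  have key : ∀ r : R, algebraMap R L r ∈ IntermediateField.adjoin K (algebraMap R L '' S) := by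
    intro r
    have hr : r ∈ Algebra.adjoin A S := hS ▸ Algebra.mem_top
    induction hr using Algebra.adjoin_induction with
    | mem x hx => exact IntermediateField.subset_adjoin _ _ ⟨x, hx, rfl⟩
    | algebraMap a =>
      rw [← IsScalarTower.algebraMap_apply, IsScalarTower.algebraMap_apply A K L]
      exact IntermediateField.algebraMap_mem _ _
    | add x y _ _ hx hy => rw [map_add]; exact add_mem hx hy
    | mul x y _ _ hx hy => rw [map_mul]; exact mul_mem hx hy
  intro x _
  obtain ⟨a, b, -, rfl⟩ := IsFractionRing.div_surjective (A := R) x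
  exact div_mem (key a) (key b)

variable (K L) in
theorem normal_of_splitting (hS : Algebra.adjoin A S = ⊤)
    (hsplit : ∀ s ∈ S, ∃ (p : A[X]) (l : Multiset R),
      p.map (algebraMap A R) = (l.map fun r => X - C r).prod ∧ s ∈ l ∧ ∀ r ∈ l, r ∈ S) :
    Normal K L := by
  have hint : ∀ x ∈ algebraMap R L '' S, IsIntegral K x ∧
      ((minpoly K x).map (algebraMap K L)).Splits := by
    rintro _ ⟨s, hs, rfl⟩
    obtain ⟨p, l, h, hsl, -⟩ := hsplit s hs
    exact isIntegral_and_splits_of_eq_prod h hsl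
  have htop := adjoin_image_eq_top K L hS
  have halg := IntermediateField.isAlgebraic_adjoin (K := K) (S := algebraMap R L '' S)
    fun x hx => (hint x hx).1
  rw [normal_iff]
  intro x
  have hx : x ∈ IntermediateField.adjoin K (algebraMap R L '' S) := htop ▸ trivial
  refine ⟨?_, IntermediateField.splits_of_mem_adjoin K L hint hx⟩
  have h1 : IsAlgebraic K (⟨x, hx⟩ : IntermediateField.adjoin K (algebraMap R L '' S)) :=
    halg.isAlgebraic _
  exact (h1.algebraMap (A := L)).isIntegral

variable [IsDomain A] [IsFractionRing A K]

variable (K L) in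
include K L in
theorem splits_of_splitting (hS : Algebra.adjoin A S = ⊤)
    (hsplit : ∀ s ∈ S, ∃ (p : A[X]) (l : Multiset R),
      p.map (algebraMap A R) = (l.map fun r => X - C r).prod ∧ s ∈ l ∧ ∀ r ∈ l, r ∈ S)
    {c : R} {p : A[X]} (hp : p.Monic) (hpc : aeval c p = 0)
    (hmin : ∀ q : A[X], q ≠ 0 → aeval c q = 0 → p.natDegree ≤ q.natDegree) :
    (p.map (algebraMap A R)).Splits := by
  have := normal_of_splitting K L hS hsplit
  have hc : aeval (algebraMap R L c) (p.map (algebraMap A K)) = 0 := by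
    rw [aeval_map_algebraMap, aeval_algebraMap_apply, hpc, map_zero]
  have hint : IsIntegral K (algebraMap R L c) := Normal.isIntegral this _
  have hpmin : p.map (algebraMap A K) = minpoly K (algebraMap R L c) := by
    refine (eq_of_monic_of_dvd_of_natDegree_le (minpoly.monic hint) (hp.map _)
      (minpoly.dvd K _ hc) ?_)
    rw [hp.natDegree_map]
    set q := IsLocalization.integerNormalization (nonZeroDivisors A)
      (minpoly K (algebraMap R L c)) with hq
    have hq0 : q ≠ 0 := fun h => minpoly.ne_zero hint
      (IsFractionRing.integerNormalization_eq_zero_iff.1 h)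
    have hqc : aeval c q = 0 := by
      apply IsFractionRing.injective R L
      rw [map_zero, ← aeval_algebraMap_apply]
      exact IsLocalization.integerNormalization_aeval_eq_zero _ _ (minpoly.aeval K _)
    refine (hmin q hq0 hqc).trans ?_
    exact natDegree_le_natDegree (degree_mono
      (IsLocalization.integerNormalization_support _ _))
  refine Splits.of_splits_map_of_injective (IsFractionRing.injective R L) ?_ fun a ha => ?_
  all_goals rw [map_map, ← IsScalarTower.algebraMap_eq, IsScalarTower.algebraMap_eq A K L,
    ← map_map, hpmin] at *
  · exact Normal.splits this _
  · have h0 : aeval a (minpoly K (algebraMap R L c)) = 0 := by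
      rw [aeval_def, ← eval_map]
      exact isRoot_of_mem_roots ha
    obtain ⟨σ, rfl⟩ := minpoly.exists_algEquiv_of_root' hint.isAlgebraic h0
    exact exists_algebraMap_eq_apply hS hsplit σ c

variable (K L) in
include K L in
theorem exists_mul_eq_of_fixed (hS : Algebra.adjoin A S = ⊤)
    (hsplit : ∀ s ∈ S, ∃ (p : A[X]) (l : Multiset R), l.Nodup ∧
      p.map (algebraMap A R) = (l.map fun r => X - C r).prod ∧ s ∈ l ∧ ∀ r ∈ l, r ∈ S)
    {x : R} (hx : ∀ σ : R ≃ₐ[A] R, σ x = x) :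
    ∃ a b : A, b ≠ 0 ∧ algebraMap A R b * x = algebraMap A R a := by
  have hsplit' : ∀ s ∈ S, ∃ (p : A[X]) (l : Multiset R),
      p.map (algebraMap A R) = (l.map fun r => X - C r).prod ∧ s ∈ l ∧ ∀ r ∈ l, r ∈ S :=
    fun s hs => let ⟨p, l, h⟩ := hsplit s hs; ⟨p, l, h.2⟩
  have := normal_of_splitting K L hS hsplit'
  have hsep : Algebra.IsSeparable K L := by
    have h := (IntermediateField.isSeparable_adjoin_iff_isSeparable K L
      (S := algebraMap R L '' S)).2 <| by
        rintro _ ⟨s, hs, rfl⟩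
        obtain ⟨p, l, hl, h, hsl, -⟩ := hsplit s hs
        have hdvd := minpoly.dvd K (algebraMap R L s) (aeval_map_eq_zero h hsl)
        refine Separable.of_dvd ?_ hdvd
        rw [← separable_map (algebraMap K L), map_map_eq_prod h,
          show (fun r => X - C (algebraMap R L r)) = (fun a : L => X - C a) ∘ algebraMap R L from rfl,
          ← Multiset.map_map, ← nodup_roots_iff_of_splits
          (monic_multiset_prod_of_monic _ _ fun r _ => monic_X_sub_C _).ne_zero
          (Splits.multisetProd fun f hf => by
            obtain ⟨r, -, rfl⟩ := Multiset.mem_map.1 hf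
            exact Splits.X_sub_C _), roots_multiset_prod_X_sub_C]
        exact hl.map (IsFractionRing.injective R L)
    rw [adjoin_image_eq_top K L hS] at h
    exact Algebra.IsSeparable.of_algHom K _ IntermediateField.topEquiv.symm.toAlgHom
  have : IsGalois K L := IsGalois.mk
  have hfix : ∀ σ : L ≃ₐ[K] L, σ (algebraMap R L x) = algebraMap R L x := by
    intro σ
    let ι : R →ₐ[A] L := IsScalarTower.toAlgHom A R L
    let e : R ≃ₐ[A] ι.range := AlgEquiv.ofInjective ι (IsFractionRing.injective R L)
    have hle : ∀ τ : L ≃ₐ[K] L, ι.range.map ((τ.restrictScalars A : L ≃ₐ[A] L) : L →ₐ[A] L) ≤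
        ι.range := by
      rintro τ _ ⟨_, ⟨r, rfl⟩, rfl⟩
      obtain ⟨r', hr'⟩ := exists_algebraMap_eq_apply hS hsplit' τ r
      exact ⟨r', hr'⟩
    have hmap : ι.range.map ((σ.restrictScalars A : L ≃ₐ[A] L) : L →ₐ[A] L) = ι.range := by
      refine le_antisymm (hle σ) fun y hy => ?_
      exact ⟨σ.symm y, hle σ.symm ⟨y, hy, rfl⟩, σ.apply_symm_apply y⟩
    let τ : R ≃ₐ[A] R := (e.trans ((σ.restrictScalars A).subalgebraMap ι.range)).trans
      ((Subalgebra.equivOfEq _ _ hmap).trans e.symm)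
    have hτ : ∀ r, algebraMap R L (τ r) = σ (algebraMap R L r) := fun r => by
      have : e (τ r) = Subalgebra.equivOfEq _ _ hmap
          ((σ.restrictScalars A).subalgebraMap ι.range (e r)) := e.apply_symm_apply _
      exact congrArg Subtype.val this
    rw [← hτ, hx]
  obtain ⟨k, hk⟩ := IntermediateField.mem_bot.1 ((InfiniteGalois.mem_bot_iff_fixed _).2 hfix)
  obtain ⟨a, b, hb, rfl⟩ := IsFractionRing.div_surjective (A := A) k
  have hb0 : b ≠ 0 := nonZeroDivisors.ne_zero hb
  refine ⟨a, b, hb0, IsFractionRing.injective R L ?_⟩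
  have hbK : algebraMap A K b ≠ 0 := fun h =>
    hb0 (IsFractionRing.injective A K (by rw [h, map_zero]))
  rw [map_mul, ← IsScalarTower.algebraMap_apply, ← IsScalarTower.algebraMap_apply, ← hk,
    IsScalarTower.algebraMap_apply A K L, IsScalarTower.algebraMap_apply A K L, ← map_mul,
    mul_div_cancel₀ _ hbK]

end SplittingDomain

section CommDomain

open Polynomial

variable {A R : Type*} [CommRing A] [CommRing R] [IsDomain R] [Algebra A R]

section FractionField

variable [IsDomain A] [FaithfulSMul A R] {S : Set R}

theorem splits_of_splitting_domain (hS : Algebra.adjoin A S = ⊤)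
    (hsplit : ∀ s ∈ S, ∃ (p : A[X]) (l : Multiset R),
      p.map (algebraMap A R) = (l.map fun r => X - C r).prod ∧ s ∈ l ∧ ∀ r ∈ l, r ∈ S)
    {c : R} {p : A[X]} (hp : p.Monic) (hpc : aeval c p = 0)
    (hmin : ∀ q : A[X], q ≠ 0 → aeval c q = 0 → p.natDegree ≤ q.natDegree) :
    (p.map (algebraMap A R)).Splits := by
  let := FractionRing.liftAlgebra A (FractionRing R)
  have := FractionRing.isScalarTower_liftAlgebra A (FractionRing R)
  exact splits_of_splitting (FractionRing A) (FractionRing R) hS hsplit hp hpc hmin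

theorem exists_mul_eq_of_fixed_domain (hS : Algebra.adjoin A S = ⊤)
    (hsplit : ∀ s ∈ S, ∃ (p : A[X]) (l : Multiset R), l.Nodup ∧
      p.map (algebraMap A R) = (l.map fun r => X - C r).prod ∧ s ∈ l ∧ ∀ r ∈ l, r ∈ S)
    {x : R} (hx : ∀ σ : R ≃ₐ[A] R, σ x = x) :
    ∃ a b : A, b ≠ 0 ∧ algebraMap A R b * x = algebraMap A R a := by
  let := FractionRing.liftAlgebra A (FractionRing R)
  have := FractionRing.isScalarTower_liftAlgebra A (FractionRing R)
  exact exists_mul_eq_of_fixed (FractionRing A) (FractionRing R) hS hsplit hx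

end FractionField

/-- If `A` is the fixed ring of a group of automorphisms of a domain `R`, every element of `R`
integral over `A` is a root of the polynomial over `A` whose roots are its distinct conjugates. -/
theorem exists_orbit_polynomial (G : Subgroup (RingAut R))
    (hG : ∀ σ ∈ G, ∀ a, σ (algebraMap A R a) = algebraMap A R a)
    (hfix : ∀ x : R, (∀ σ ∈ G, σ x = x) → ∃ a, algebraMap A R a = x) {x : R}
    (hx : IsIntegral A x) :
    ∃ (p : A[X]) (l : Multiset R), l.Nodup ∧
      p.map (algebraMap A R) = (l.map fun r => X - C r).prod ∧ x ∈ l ∧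
        ∀ r ∈ l, ∃ σ ∈ G, r = σ x := by
  classical
  obtain ⟨q, hq, hqx⟩ := hx
  have hfin : {r | ∃ σ ∈ G, r = σ x}.Finite := by
    refine (q.map (algebraMap A R)).roots.toFinset.finite_toSet.subset ?_
    rintro _ ⟨σ, hσ, rfl⟩
    have h0 := congrArg σ hqx
    rw [map_zero, ← RingEquiv.coe_toRingHom, hom_eval₂] at h0
    have hcomp : (σ : R →+* R).comp (algebraMap A R) = algebraMap A R :=
      RingHom.ext fun a => hG σ hσ a
    rw [Finset.mem_coe, Multiset.mem_toFinset, mem_roots (hq.map _).ne_zero, IsRoot, eval_map]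
    simpa [hcomp] using h0
  set s := hfin.toFinset with hs
  have hmem : ∀ r, r ∈ s ↔ ∃ σ ∈ G, r = σ x := fun r => hfin.mem_toFinset
  set P : R[X] := ∏ r ∈ s, (X - C r) with hP
  have hinv : ∀ σ ∈ G, P.map (σ : R →+* R) = P := by
    intro σ hσ
    rw [hP, Polynomial.map_prod]
    refine Finset.prod_bij (fun r _ => σ r) (fun r hr => ?_) (fun _ _ _ _ h => σ.injective h)
      (fun r hr => ?_) (fun r _ => by simp)
    · obtain ⟨τ, hτ, rfl⟩ := (hmem r).1 hr
      exact (hmem _).2 ⟨σ * τ, G.mul_mem hσ hτ, rfl⟩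
    · obtain ⟨τ, hτ, rfl⟩ := (hmem r).1 hr
      exact ⟨σ⁻¹ (τ x), (hmem _).2 ⟨σ⁻¹ * τ, G.mul_mem (G.inv_mem hσ) hτ, rfl⟩,
        σ.apply_symm_apply _⟩
  have hlift : P ∈ lifts (algebraMap A R) := by
    rw [lifts_iff_coeff_lifts]
    intro n
    refine hfix _ fun σ hσ => ?_
    conv_rhs => rw [← hinv σ hσ, coeff_map]
    rfl
  obtain ⟨p, hp⟩ := (mem_lifts P).1 hlift
  exact ⟨p, s.val, s.nodup, hp, (hmem x).2 ⟨1, G.one_mem, rfl⟩, fun r hr => (hmem r).1 hr⟩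

end CommDomain

section CommSubring

open Polynomial

variable {D : Type*} [Ring D] {F L L' : Subring D}

/-- A subring whose elements commute is a commutative ring. -/
abbrev commRingOfCommute (L : Subring D) (hL : ∀ x ∈ L, ∀ y ∈ L, x * y = y * x) : CommRing L :=
  { (inferInstance : Ring L) with
    mul_comm := fun x y => Subtype.ext (hL x x.2 y y.2) }

theorem map_inclusion_eq_prod_iff (h : F ≤ L) {p : Polynomial F} {l : List L} :
    p.map (Subring.inclusion h) = (l.map fun r => X - C r).prod ↔
      p.map F.subtype = ((l.map Subtype.val).map fun r : D => X - C r).prod := by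
  rw [← (map_injective L.subtype Subtype.val_injective).eq_iff, map_map,
    ← coe_mapRingHom L.subtype, map_list_prod, List.map_map, List.map_map]
  have h1 : L.subtype.comp (Subring.inclusion h) = F.subtype := rfl
  have h2 : (mapRingHom L.subtype : L[X] → D[X]) ∘ (fun r : L => X - C r) =
      (fun r : D => X - C r) ∘ Subtype.val := by
    ext1 r
    simp
  rw [h1, h2]

theorem splitsIn_iff (h : F ≤ L) {p : Polynomial F} :
    SplitsIn h p ↔ ∃ l : List D, (∀ r ∈ l, r ∈ L) ∧
      p.map F.subtype = (l.map fun r => X - C r).prod := by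
  refine ⟨fun ⟨s, hs⟩ => ⟨s.map Subtype.val, fun r hr => ?_, (map_inclusion_eq_prod_iff h).1 hs⟩,
    fun ⟨l, hl, hp⟩ => ?_⟩
  · obtain ⟨a, -, rfl⟩ := List.mem_map.1 hr
    exact a.2
  · lift l to List L using hl
    exact ⟨l, (map_inclusion_eq_prod_iff h).2 hp⟩

theorem mem_of_le_closure {S : Set D} (hgen : L ≤ Subring.closure (F ∪ S)) {E : Subring L}
    (hF : ∀ x : L, (x : D) ∈ F → x ∈ E) (hS : ∀ x : L, (x : D) ∈ S → x ∈ E) (hFL : F ≤ L)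
    (hSL : S ⊆ L) (x : L) : x ∈ E := by
  have hle : Subring.closure (F ∪ S) ≤ E.map L.subtype := by
    rw [Subring.closure_le]
    rintro y (hy | hy)
    · exact ⟨⟨y, hFL hy⟩, hF _ hy, rfl⟩
    · exact ⟨⟨y, hSL hy⟩, hS _ hy, rfl⟩
  obtain ⟨y, hy, hyx⟩ := hle (hgen x.2)
  rwa [← Subtype.ext hyx]

section Splitting

variable [IsDomain D] {S : Set D}

theorem splitsIn_of_splitting (hL : ∀ x ∈ L, ∀ y ∈ L, x * y = y * x) (hFL : F ≤ L)
    (hSL : S ⊆ L) (hgen : L ≤ Subring.closure (F ∪ S))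
    (hsplit : ∀ s ∈ S, ∃ (p : Polynomial F) (l : List D),
      p.map F.subtype = (l.map fun r => X - C r).prod ∧ s ∈ l ∧ ∀ r ∈ l, r ∈ S)
    {c : D} (hc : c ∈ L) {p : Polynomial F} (hp : p.Monic) (hpc : eval₂ F.subtype c p = 0)
    (hmin : ∀ q : Polynomial F, q ≠ 0 → eval₂ F.subtype c q = 0 → p.natDegree ≤ q.natDegree) :
    SplitsIn hFL p := by
  let := commRingOfCommute L hL
  let := commRingOfCommute F fun x hx y hy => hL x (hFL hx) y (hFL hy)
  let : Algebra F L := (Subring.inclusion hFL).toAlgebra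
  have : FaithfulSMul F L :=
    (faithfulSMul_iff_algebraMap_injective F L).2 (Subring.inclusion_injective hFL)
  have hS : Algebra.adjoin F (Subtype.val ⁻¹' S : Set L) = ⊤ :=
    Algebra.eq_top_iff.2 <| mem_of_le_closure (E := (Algebra.adjoin F _).toSubring) hgen
      (fun x hx => Subalgebra.algebraMap_mem _ (⟨x, hx⟩ : F))
      (fun x hx => Algebra.subset_adjoin hx) hFL hSL
  have haeval : ∀ q : Polynomial F, aeval (⟨c, hc⟩ : L) q = 0 ↔ eval₂ F.subtype c q = 0 := by
    intro q
    have h : ((aeval (⟨c, hc⟩ : L) q : L) : D) = eval₂ F.subtype c q :=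
      hom_eval₂ q (algebraMap F L) L.subtype _
    exact ⟨fun h' => by rw [← h, h']; rfl, fun h' => Subtype.ext (h.trans h')⟩
  have h := splits_of_splitting_domain hS (fun s hs => by
    obtain ⟨p, l, hpl, hsl, hr⟩ := hsplit s hs
    lift l to List L using fun r hr' => hSL (hr r hr')
    exact ⟨p, l, ((map_inclusion_eq_prod_iff hFL).2 hpl).trans (Multiset.prod_coe _).symm,
      (List.mem_map_of_injective Subtype.val_injective).1 hsl,
      fun r hr' => hr _ (List.mem_map_of_mem hr')⟩) hp ((haeval p).2 hpc)
    fun q hq hqc => hmin q hq ((haeval q).1 hqc)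
  obtain ⟨m, hm⟩ := splits_iff_exists_multiset.1 h
  rw [(hp.map _).leadingCoeff, C_1, one_mul] at hm
  obtain ⟨l, rfl⟩ := Quotient.exists_rep m
  exact ⟨l, hm.trans (Multiset.prod_coe _)⟩

theorem exists_mul_eq_of_forall_fixed (hL : ∀ x ∈ L, ∀ y ∈ L, x * y = y * x) (hFL : F ≤ L)
    (hSL : S ⊆ L) (hgen : L ≤ Subring.closure (F ∪ S))
    (hsplit : ∀ s ∈ S, ∃ (p : Polynomial F) (l : List D), l.Nodup ∧
      p.map F.subtype = (l.map fun r => X - C r).prod ∧ s ∈ l ∧ ∀ r ∈ l, r ∈ S)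
    {x : L} (hx : ∀ σ : L ≃+* L, (∀ y : L, (y : D) ∈ F → σ y = y) → σ x = x) :
    ∃ a ∈ F, ∃ b ∈ F, b ≠ 0 ∧ b * x = a := by
  let := commRingOfCommute L hL
  let := commRingOfCommute F fun x hx y hy => hL x (hFL hx) y (hFL hy)
  let : Algebra F L := (Subring.inclusion hFL).toAlgebra
  have : FaithfulSMul F L :=
    (faithfulSMul_iff_algebraMap_injective F L).2 (Subring.inclusion_injective hFL)
  have hS : Algebra.adjoin F (Subtype.val ⁻¹' S : Set L) = ⊤ :=
    Algebra.eq_top_iff.2 <| mem_of_le_closure (E := (Algebra.adjoin F _).toSubring) hgen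
      (fun x hx => Subalgebra.algebraMap_mem _ (⟨x, hx⟩ : F))
      (fun x hx => Algebra.subset_adjoin hx) hFL hSL
  obtain ⟨a, b, hb, h⟩ := exists_mul_eq_of_fixed_domain hS (x := x) (fun s hs => by
    obtain ⟨p, l, hl, hpl, hsl, hr⟩ := hsplit s hs
    lift l to List L using fun r hr' => hSL (hr r hr')
    exact ⟨p, l, hl.of_map _,
      ((map_inclusion_eq_prod_iff hFL).2 hpl).trans (Multiset.prod_coe _).symm,
      (List.mem_map_of_injective Subtype.val_injective).1 hsl,
      fun r hr' => hr _ (List.mem_map_of_mem hr')⟩)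
    fun σ => hx σ.toRingEquiv fun y hy => σ.commutes ⟨y, hy⟩
  exact ⟨a, a.2, b, b.2, fun h => hb (Subtype.ext h), congrArg Subtype.val h⟩

/-- Elements of a commutative subring `L` integral over the fixed ring `F` of a group of
automorphisms of `L` are roots of polynomials over `F` whose roots are distinct conjugates. -/
theorem exists_orbit_list (hL : ∀ x ∈ L, ∀ y ∈ L, x * y = y * x) (hFL : F ≤ L)
    (G : Subgroup (RingAut L)) (hG : ∀ σ ∈ G, ∀ y : L, (y : D) ∈ F → σ y = y)
    (hfix : ∀ x : L, (∀ σ ∈ G, σ x = x) → (x : D) ∈ F) (x : L)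
    (hx : ∃ q : Polynomial F, q.Monic ∧ eval₂ F.subtype (x : D) q = 0) :
    ∃ (p : Polynomial F) (l : List D), l.Nodup ∧
      p.map F.subtype = (l.map fun r => X - C r).prod ∧ (x : D) ∈ l ∧
        ∀ r ∈ l, ∃ σ ∈ G, r = σ x := by
  let := commRingOfCommute L hL
  let := commRingOfCommute F fun x hx y hy => hL x (hFL hx) y (hFL hy)
  let : Algebra F L := (Subring.inclusion hFL).toAlgebra
  obtain ⟨q, hq, hqx⟩ := hx
  have hint : IsIntegral F x := by
    refine ⟨q, hq, Subtype.val_injective (Eq.trans ?_ hqx)⟩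
    exact hom_eval₂ q (algebraMap F L) L.subtype x
  obtain ⟨p, m, hm, hpm, hxm, h⟩ := exists_orbit_polynomial (A := F) G
    (fun σ hσ a => hG σ hσ _ a.2) (fun y hy => ⟨⟨y, hfix y hy⟩, rfl⟩) hint
  obtain ⟨l, rfl⟩ := Quotient.exists_rep m
  refine ⟨p, l.map Subtype.val, List.Nodup.map Subtype.val_injective hm,
    (map_inclusion_eq_prod_iff hFL).1 (hpm.trans (Multiset.prod_coe _)),
    List.mem_map_of_mem hxm, fun r hr => ?_⟩
  obtain ⟨r', hr', rfl⟩ := List.mem_map.1 hr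
  obtain ⟨σ, hσ, rfl⟩ := h r' hr'
  exact ⟨σ, hσ, rfl⟩

end Splitting

end CommSubring

section Conjugates

open Polynomial

variable {D : Type*} [Ring D] {F L : Subring D}

theorem eval₂_ringEquiv_eq_zero (hFL : F ≤ L) {σ : L ≃+* L}
    (hσ : ∀ y : L, (y : D) ∈ F → σ y = y) {c : L} {q : Polynomial F}
    (h : eval₂ F.subtype (c : D) q = 0) : eval₂ F.subtype (σ c : D) q = 0 := by
  have key : ∀ x : L, eval₂ F.subtype (x : D) q = (eval₂ (Subring.inclusion hFL) x q : L) :=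
    fun x => (hom_eval₂ q (Subring.inclusion hFL) L.subtype x).symm
  have hcomp : (σ : L →+* L).comp (Subring.inclusion hFL) = Subring.inclusion hFL :=
    RingHom.ext fun a => hσ _ a.2
  have h0 := hom_eval₂ q (Subring.inclusion hFL) (σ : L →+* L) c
  rw [hcomp] at h0
  rw [key, ← RingEquiv.coe_toRingHom, ← h0, (Subtype.ext ((key c).symm.trans h) :
    eval₂ (Subring.inclusion hFL) c q = 0), map_zero]
  rfl

theorem eval₂_eq_zero_iff_mem [IsDomain D] (hL : ∀ x ∈ L, ∀ y ∈ L, x * y = y * x) (hFL : F ≤ L)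
    {p : Polynomial F} {l : List D} (hl : ∀ r ∈ l, r ∈ L)
    (hp : p.map F.subtype = (l.map fun r => X - C r).prod) {r : D} (hr : r ∈ L) :
    eval₂ F.subtype r p = 0 ↔ r ∈ l := by
  let := commRingOfCommute L hL
  lift l to List L using hl
  have h1 : p.map (Subring.inclusion hFL) = (l.map fun r => X - C r).prod :=
    (map_inclusion_eq_prod_iff hFL).2 hp
  have h2 : ((eval₂ (Subring.inclusion hFL) (⟨r, hr⟩ : L) p : L) : D) = eval₂ F.subtype r p :=
    hom_eval₂ p (Subring.inclusion hFL) L.subtype _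
  rw [← h2, ← eval_map, h1, eval_list_prod, List.map_map]
  rw [ZeroMemClass.coe_eq_zero, List.prod_eq_zero_iff]
  simp only [List.mem_map, Function.comp_apply, eval_sub, eval_X, eval_C, sub_eq_zero]
  exact exists_congr fun a => and_congr_right fun _ => Subtype.ext_iff.trans eq_comm

/-- The automorphisms of `L` fixing the elements of `F`. -/
def fixingAut (F L : Subring D) : Subgroup (RingAut L) where
  carrier := {σ | ∀ y : L, (y : D) ∈ F → σ y = y}
  one_mem' := fun _ _ => rfl
  mul_mem' := fun {σ τ} hσ hτ y hy => by rw [RingAut.mul_apply, hτ y hy, hσ y hy]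
  inv_mem' := fun {σ} hσ y hy => by
    conv_lhs => rw [← hσ y hy]
    exact σ.symm_apply_apply y

variable {Γ : Type*} [AddCommGroup Γ] [DecidableEq Γ] {𝒜 : Γ → AddSubgroup D} [GradedRing 𝒜]
  {M T : Subring D}

variable (hΓ : TorsionFree Γ) (hD : IsGradedDivisionRing 𝒜) (hFcen : F = Subring.center D)
  (hfin : finiteOver F)
include hΓ hD hFcen hfin

/-- Conjugates in `M` of homogeneous elements of `M ∩ C_D(T)` remain in `M ∩ C_D(T)`. -/
theorem mem_inf_centralizer_of_conjugate (hM : IsMaxGradedSubfieldOf 𝒜 ⊤ M)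
    (hT : IsMaxGradedSubfieldOf 𝒜 (Cc 𝒜 F) T) {γ : Γ} {c r : D}
    (hc : c ∈ M ⊓ Subring.centralizer (T : Set D)) (hcγ : c ∈ 𝒜 γ) (hr : r ∈ M)
    (h : ∀ q : Polynomial F, eval₂ F.subtype c q = 0 → eval₂ F.subtype r q = 0) :
    r ∈ M ⊓ Subring.centralizer (T : Set D) ∧ r ∈ 𝒜 γ := by
  have hF : IsGradedDivSubring 𝒜 F := hFcen ▸ isGradedDivSubring_center hD
  have hrγ := mem_grade_of_conjugate hΓ hD hF hFcen hfin hcγ (hM.1.2 c hc.1 r hr) h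
  refine ⟨⟨hr, ?_⟩, hrγ⟩
  by_cases h0 : c = 0
  · have := h X (by rw [eval₂_X, h0])
    rw [eval₂_X] at this
    rw [this]
    exact Subring.zero_mem _
  obtain ⟨e, he, hce, hec⟩ := hD.exists_inv hcγ h0
  have hre : r * e ∈ 𝒜 0 := by
    have := mul_mem_grade 𝒜 hrγ he
    rwa [add_neg_cancel] at this
  have := Subring.mul_mem _ (mem_centralizer_of_grade_zero hFcen hT hre) hc.2
  rwa [mul_assoc, hec, mul_one] at this

/-- Homogeneous elements of a maximal graded subfield `T` of `C` are separable over `F`, and all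
their conjugates lie in `T`. -/
theorem exists_splitting_of_mem_Cc (hT : IsMaxGradedSubfieldOf 𝒜 (Cc 𝒜 F) T) {γ : Γ} {c : D}
    [IsDomain D] (hc : c ∈ T) (hcγ : c ∈ 𝒜 γ) :
    ∃ (p : Polynomial F) (l : List D), l.Nodup ∧ p.map F.subtype = (l.map fun r => X - C r).prod ∧
      c ∈ l ∧ ∀ r ∈ l, r ∈ T ∧ r ∈ 𝒜 γ := by
  have hF : IsGradedDivSubring 𝒜 F := hFcen ▸ isGradedDivSubring_center hD
  have hFT := le_of_isMaxGradedSubfieldOf_Cc hD hFcen hT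
  have hG : ∀ σ ∈ conjGroup 𝒜 ⊤ T, ∀ y : T, (y : D) ∈ F → σ y = y := by
    rintro σ ⟨δ, x, x', -, -, -, -, hxx', -, hσ⟩ y hy
    apply Subtype.ext
    rw [hFcen] at hy
    rw [hσ, Subring.mem_center_iff.1 hy, mul_assoc, hxx', mul_one]
  obtain ⟨p, l, hl, hp, hcl, h⟩ := exists_orbit_list hT.1.2 hFT (conjGroup 𝒜 ⊤ T) hG
    (fun t ht => by
      rw [hFcen, Subring.mem_center_iff]
      have := mem_centralizer_of_commute_homogeneous (𝒜 := 𝒜) (E := ⊤) (x := (t : D))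
        isGradedSubring_top fun δ d _ hd => by
          by_cases h0 : d = 0
          · rw [h0, zero_mul, mul_zero]
          obtain ⟨e, he, hde, hed⟩ := hD.exists_inv hd h0
          have := ht (conjAut T d e hde hed
            (fun b hb => conj_mem_of_isMaxGradedSubfieldOf_Cc hD hFcen hT hd hde hb)
            (fun b hb => conj_mem_of_isMaxGradedSubfieldOf_Cc hD hFcen hT he hed hb))
            ⟨δ, d, e, trivial, trivial, hd, he, hde, hed, fun _ => rfl⟩
          have : d * t * e = t := congrArg Subtype.val this
          conv_rhs => rw [← this]
          rw [mul_assoc _ e d, hed, mul_one]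
      exact fun d => Subring.mem_centralizer_iff.1 this d trivial)
    ⟨c, hc⟩ (exists_monic_eval₂_eq_zero hFcen hfin c)
  refine ⟨p, l, hl, hp, hcl, fun r hr => ?_⟩
  obtain ⟨σ, hσ, rfl⟩ := h r hr
  exact ⟨Subtype.property _, mem_grade_of_conjugate hΓ hD hF hFcen hfin hcγ
    (hT.1.2 _ hc _ (Subtype.property _)) fun q hq => eval₂_ringEquiv_eq_zero hFT (hG σ hσ) hq⟩

theorem exists_splitting_of_isGaloisExt (hM : IsMaxGradedSubfieldOf 𝒜 ⊤ M)
    (hT : IsMaxGradedSubfieldOf 𝒜 (Cc 𝒜 F) T) (hgal : IsGaloisExt F M) {γ : Γ} {c : D}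
    [IsDomain D] (hc : c ∈ M ⊓ Subring.centralizer (T : Set D)) (hcγ : c ∈ 𝒜 γ) :
    ∃ (p : Polynomial F) (l : List D), l.Nodup ∧ p.map F.subtype = (l.map fun r => X - C r).prod ∧
      c ∈ l ∧ ∀ r ∈ l, r ∈ M ⊓ Subring.centralizer (T : Set D) ∧ r ∈ 𝒜 γ := by
  obtain ⟨p, l, hl, hp, hcl, h⟩ := exists_orbit_list hM.1.2 hgal.1 (fixingAut F M)
    (fun σ hσ => hσ) hgal.2 ⟨c, hc.1⟩ (exists_monic_eval₂_eq_zero hFcen hfin c)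
  refine ⟨p, l, hl, hp, hcl, fun r hr => ?_⟩
  obtain ⟨σ, hσ, rfl⟩ := h r hr
  exact mem_inf_centralizer_of_conjugate hΓ hD hFcen hfin hM hT hc hcγ (Subtype.property _)
    fun q hq => eval₂_ringEquiv_eq_zero hgal.1 hσ hq

theorem exists_splitting_of_isNormalExtGr (hM : IsMaxGradedSubfieldOf 𝒜 ⊤ M)
    (hT : IsMaxGradedSubfieldOf 𝒜 (Cc 𝒜 F) T) (hnor : IsNormalExtGr 𝒜 F M) {γ : Γ} {c : D}
    [IsDomain D] (hc : c ∈ M ⊓ Subring.centralizer (T : Set D)) (hcγ : c ∈ 𝒜 γ) :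
    ∃ (p : Polynomial F) (l : List D), p.map F.subtype = (l.map fun r => X - C r).prod ∧
      c ∈ l ∧ ∀ r ∈ l, r ∈ M ⊓ Subring.centralizer (T : Set D) ∧ r ∈ 𝒜 γ := by
  have hF : IsGradedDivSubring 𝒜 F := hFcen ▸ isGradedDivSubring_center hD
  obtain ⟨hFM, hnor⟩ := hnor
  obtain ⟨p, hp⟩ := exists_isMinPolyOf hFcen hfin c
  obtain ⟨l, hl, hpl⟩ := (splitsIn_iff hFM).1 (hnor c hc.1 ⟨γ, hcγ⟩ p hp)
  have hroot := fun r hr => eval₂_eq_zero_iff_mem (r := r) hM.1.2 hFM hl hpl hr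
  exact ⟨p, l, hpl, (hroot c hc.1).1 hp.2.1, fun r hr =>
    mem_inf_centralizer_of_conjugate hΓ hD hFcen hfin hM hT hc hcγ (hl r hr) fun q hq =>
      hp.eval₂_eq_zero hD hF hFcen.le hcγ ((hroot r (hl r hr)).2 hr) hq⟩

end Conjugates

section DescendedExtensions

open Polynomial

variable {Γ : Type*} [AddCommGroup Γ] [DecidableEq Γ] {D : Type*} [Ring D]
  {𝒜 : Γ → AddSubgroup D} [GradedRing 𝒜] {F L M T : Subring D}

/-- The homogeneous elements of `M ∩ C_D(T)` and of `T`. -/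
def homogeneousGenerators (𝒜 : Γ → AddSubgroup D) (M T : Subring D) : Set D :=
  {c | ∃ γ, c ∈ 𝒜 γ ∧ (c ∈ M ⊓ Subring.centralizer (T : Set D) ∨ c ∈ T)}

omit [AddCommGroup Γ] [DecidableEq Γ] [GradedRing 𝒜] in
theorem homogeneousGenerators_subset : homogeneousGenerators 𝒜 M T ⊆ descended M T := by
  rintro c ⟨γ, -, h | h⟩
  · exact (le_sup_left : _ ≤ descended M T) h
  · exact (le_sup_right : _ ≤ descended M T) h

theorem descended_le_closure (hD : IsGradedDivisionRing 𝒜) (hM : IsGradedSubring 𝒜 M)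
    (hT : IsGradedSubring 𝒜 T) :
    descended M T ≤ Subring.closure (F ∪ homogeneousGenerators 𝒜 M T) := by
  have hN : IsGradedSubring 𝒜 (M ⊓ Subring.centralizer (T : Set D)) := fun x hx γ =>
    ⟨hM x hx.1 γ, (isGradedDivSubring_centralizer hD hT).1 x hx.2 γ⟩
  refine sup_le (fun x hx => mem_of_proj_mem 𝒜 fun γ => Subring.subset_closure (Or.inr ?_))
    (fun x hx => mem_of_proj_mem 𝒜 fun γ => Subring.subset_closure (Or.inr ?_))
  · exact ⟨γ, proj_mem 𝒜 γ x, Or.inl (hN.proj_mem hx γ)⟩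
  · exact ⟨γ, proj_mem 𝒜 γ x, Or.inr (hT.proj_mem hx γ)⟩

variable (hΓ : TorsionFree Γ) (hD : IsGradedDivisionRing 𝒜) (hFcen : F = Subring.center D)
  (hfin : finiteOver F)
include hΓ hD hFcen hfin

/-- The degree zero part of a commutative Galois extension of the center is Galois. -/
theorem IsGaloisExt.inf_grade0 (hL : ∀ x ∈ L, ∀ y ∈ L, x * y = y * x) (h : IsGaloisExt F L) :
    IsGaloisExt (F ⊓ grade0 𝒜) (L ⊓ grade0 𝒜) := by
  have hF : IsGradedDivSubring 𝒜 F := hFcen ▸ isGradedDivSubring_center hD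
  refine ⟨inf_le_inf_right _ h.1, fun x hx => ⟨h.2 ⟨x, x.2.1⟩ fun σ hσ => ?_, x.2.2⟩⟩
  have key : ∀ τ ∈ fixingAut F L, ∀ b : L, (b : D) ∈ 𝒜 0 → (τ b : D) ∈ 𝒜 0 := fun τ hτ b hb =>
    mem_grade_of_conjugate hΓ hD hF hFcen hfin hb (hL _ b.2 _ (τ b).2)
      fun q hq => eval₂_ringEquiv_eq_zero h.1 hτ hq
  let τ : ↥(L ⊓ grade0 𝒜) ≃+* ↥(L ⊓ grade0 𝒜) :=
    { toFun := fun b => ⟨σ ⟨b, b.2.1⟩, (σ _).2, key σ hσ _ b.2.2⟩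
      invFun := fun b => ⟨σ.symm ⟨b, b.2.1⟩, (σ.symm _).2,
        key σ⁻¹ ((fixingAut F L).inv_mem hσ) _ b.2.2⟩
      left_inv := fun b => Subtype.ext
        (congrArg (Subtype.val : L → D) (σ.symm_apply_apply ⟨b, b.2.1⟩))
      right_inv := fun b => Subtype.ext
        (congrArg (Subtype.val : L → D) (σ.apply_symm_apply ⟨b, b.2.1⟩))
      map_mul' := fun a b => Subtype.ext
        (congrArg (Subtype.val : L → D) (map_mul σ ⟨a, a.2.1⟩ ⟨b, b.2.1⟩))
      map_add' := fun a b => Subtype.ext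
        (congrArg (Subtype.val : L → D) (map_add σ ⟨a, a.2.1⟩ ⟨b, b.2.1⟩)) }
  have := hx τ fun y hy => Subtype.ext
    (congrArg (Subtype.val : L → D) (hσ ⟨y, y.2.1⟩ hy.1))
  exact Subtype.ext (congrArg (Subtype.val : ↥(L ⊓ grade0 𝒜) → D) this)

/-- The degree zero part of a commutative normal graded extension of the center is normal. -/
theorem IsNormalExtGr.inf_grade0 [IsDomain D] (hL : ∀ x ∈ L, ∀ y ∈ L, x * y = y * x)
    (h : IsNormalExtGr 𝒜 F L) : IsNormalExt (F ⊓ grade0 𝒜) (L ⊓ grade0 𝒜) := by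
  have hF : IsGradedDivSubring 𝒜 F := hFcen ▸ isGradedDivSubring_center hD
  obtain ⟨hFL, h⟩ := h
  refine ⟨inf_le_inf_right _ hFL, fun c hc p hp => ?_⟩
  let ι : ↥(F ⊓ grade0 𝒜) →+* F := Subring.inclusion inf_le_left
  have heval : ∀ q : Polynomial ↥(F ⊓ grade0 𝒜),
      eval₂ F.subtype c (q.map ι) = eval₂ (F ⊓ grade0 𝒜).subtype c q := fun q =>
    eval₂_map ι F.subtype c
  have hP : IsMinPolyOf F c (p.map ι) := by
    refine ⟨hp.1.map ι, (heval p).trans hp.2.1, fun q hq hqc => ?_⟩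
    obtain ⟨q', hq', hdeg, hq'c, hq'0⟩ := exists_monic_homogeneous hD hF hc.2 hq.ne_zero hqc
    have hlift : q' ∈ lifts ι := by
      rw [lifts_iff_coeff_lifts]
      intro i
      have := hq'0 i
      rw [smul_zero] at this
      exact ⟨⟨q'.coeff i, (q'.coeff i).2, this⟩, rfl⟩
    obtain ⟨q₀, rfl, -, hq₀⟩ := lifts_and_natDegree_eq_and_monic hlift hq'
    have := hp.2.2 q₀ hq₀ ((heval q₀).symm.trans hq'c)
    rw [hp.1.degree_map ι]
    refine this.trans ?_
    rw [← hq₀.degree_map ι, degree_eq_natDegree hq'.ne_zero, hdeg,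
      degree_eq_natDegree hq.ne_zero]
  obtain ⟨l, hl, hpl⟩ := (splitsIn_iff hFL).1 (h c hc.1 ⟨0, hc.2⟩ _ hP)
  rw [map_map] at hpl
  refine (splitsIn_iff _).2 ⟨l, fun r hr => ⟨hl r hr, ?_⟩, hpl⟩
  rw [← map_map] at hpl
  refine mem_grade_of_conjugate hΓ hD hF hFcen hfin hc.2 (hL c hc.1 r (hl r hr)) fun q hq => ?_
  exact hP.eval₂_eq_zero hD hF hFcen.le hc.2
    ((eval₂_eq_zero_iff_mem hL hFL hl hpl (hl r hr)).2 hr) hq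

variable (hM : IsMaxGradedSubfieldOf 𝒜 ⊤ M) (hT : IsMaxGradedSubfieldOf 𝒜 (Cc 𝒜 F) T)
include hM hT

theorem isGaloisExt_descended [IsDomain D] (hgal : IsGaloisExt F M) :
    IsGaloisExt F (descended M T) := by
  have hmax := isMaxGradedSubfieldOf_descended hD hFcen hΓ hfin hM hT
  have hle := le_of_isMaxGradedSubfieldOf_top hD hFcen hmax
  refine ⟨hle, fun x hx => ?_⟩
  obtain ⟨a, ha, b, hb, hb0, hab⟩ := exists_mul_eq_of_forall_fixed hmax.1.2 hle
    homogeneousGenerators_subset (descended_le_closure hD hM.1.1.1 hT.1.1.1) (by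
      rintro c ⟨γ, hcγ, hc | hc⟩
      · obtain ⟨p, l, hl, hp, hcl, h⟩ :=
          exists_splitting_of_isGaloisExt hΓ hD hFcen hfin hM hT hgal hc hcγ
        exact ⟨p, l, hl, hp, hcl, fun r hr => ⟨γ, (h r hr).2, Or.inl (h r hr).1⟩⟩
      · obtain ⟨p, l, hl, hp, hcl, h⟩ :=
          exists_splitting_of_mem_Cc hΓ hD hFcen hfin hT hc hcγ
        exact ⟨p, l, hl, hp, hcl, fun r hr => ⟨γ, (h r hr).2, Or.inr (h r hr).1⟩⟩) hx
  rw [hFcen, Subring.mem_center_iff] at ha hb ⊢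
  intro d
  apply mul_left_cancel₀ hb0
  rw [← mul_assoc, ← mul_assoc, hab, ← ha, ← hab, ← hb, mul_assoc]

theorem isNormalExtGr_descended [IsDomain D] (hnor : IsNormalExtGr 𝒜 F M) :
    IsNormalExtGr 𝒜 F (descended M T) := by
  have hF : IsGradedDivSubring 𝒜 F := hFcen ▸ isGradedDivSubring_center hD
  have hmax := isMaxGradedSubfieldOf_descended hD hFcen hΓ hfin hM hT
  have hle := le_of_isMaxGradedSubfieldOf_top hD hFcen hmax
  refine ⟨hle, fun c hc ⟨γ, hcγ⟩ p hp => ?_⟩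
  refine splitsIn_of_splitting hmax.1.2 hle homogeneousGenerators_subset
    (descended_le_closure hD hM.1.1.1 hT.1.1.1) ?_ hc hp.1 hp.2.1
    fun q hq hqc => hp.natDegree_le hD hF hcγ hq hqc
  rintro c ⟨γ, hcγ, hc | hc⟩
  · obtain ⟨p, l, hp, hcl, h⟩ :=
      exists_splitting_of_isNormalExtGr hΓ hD hFcen hfin hM hT hnor hc hcγ
    exact ⟨p, l, hp, hcl, fun r hr => ⟨γ, (h r hr).2, Or.inl (h r hr).1⟩⟩
  · obtain ⟨p, l, -, hp, hcl, h⟩ := exists_splitting_of_mem_Cc hΓ hD hFcen hfin hT hc hcγ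
    exact ⟨p, l, hp, hcl, fun r hr => ⟨γ, (h r hr).2, Or.inr (h r hr).1⟩⟩

end DescendedExtensions

end GradedDivPaper

namespace GradedDivPaper

/-- for a maximal graded subfield `M` of `D` and a maximal graded
subfield `T` of `𝖢`, the graded subfield `M' = (M ⊓ C_D(T))⬝T` is a maximal graded
subfield of `D` with `M'₀` a maximal subfield of `D₀`, and `M'` inherits
Galois-ness/normality over `F` from `M`, as does `M'₀` over `F₀`. -/
theorem stmt_13 {Γ : Type*} [AddCommGroup Γ] [DecidableEq Γ] {D : Type*} [Ring D]
    (hΓ : TorsionFree Γ) (𝒜 : Γ → AddSubgroup D) [GradedRing 𝒜]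
    (hD : IsGradedDivisionRing 𝒜)
    (F : Subring D) (hFcen : F = Subring.center D) (hfin : finiteOver F)
    (M T : Subring D) (hM : IsMaxGradedSubfieldOf 𝒜 ⊤ M)
    (hT : IsMaxGradedSubfieldOf 𝒜 (Cc 𝒜 F) T) :
    IsMaxGradedSubfieldOf 𝒜 ⊤ ((M ⊓ Subring.centralizer (T : Set D)) ⊔ T) ∧
    IsMaxSubfieldOf (grade0 𝒜) (((M ⊓ Subring.centralizer (T : Set D)) ⊔ T) ⊓ grade0 𝒜) ∧
    (IsGaloisExt F M →
      IsGaloisExt F ((M ⊓ Subring.centralizer (T : Set D)) ⊔ T) ∧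
      IsGaloisExt (F ⊓ grade0 𝒜)
        (((M ⊓ Subring.centralizer (T : Set D)) ⊔ T) ⊓ grade0 𝒜)) ∧
    (IsNormalExtGr 𝒜 F M →
      IsNormalExtGr 𝒜 F ((M ⊓ Subring.centralizer (T : Set D)) ⊔ T) ∧
      IsNormalExt (F ⊓ grade0 𝒜)
        (((M ⊓ Subring.centralizer (T : Set D)) ⊔ T) ⊓ grade0 𝒜)) := by
  have hdom : IsDomain D := by
    have := hD.noZeroDivisors hΓ
    have : Nontrivial D := ⟨0, 1, hD.1⟩
    exact NoZeroDivisors.to_isDomain D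
  have hmax := isMaxGradedSubfieldOf_descended hD hFcen hΓ hfin hM hT
  refine ⟨hmax, isMaxSubfieldOf_descended hD hFcen hΓ hfin hM hT, fun hgal => ?_, fun hnor => ?_⟩
  · have h := isGaloisExt_descended hΓ hD hFcen hfin hM hT hgal
    exact ⟨h, h.inf_grade0 hΓ hD hFcen hfin hmax.1.2⟩
  · have h := isNormalExtGr_descended hΓ hD hFcen hfin hM hT hnor
    exact ⟨h, h.inf_grade0 hΓ hD hFcen hfin hmax.1.2⟩

end GradedDivPaper
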